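/- arXiv:2312.16431 — 19 statements merged into one kernel-verified Lean document; each statement's English description precedes it below -/
import Mathlib

section
/- Let G be a group, let N be a positive integer, and let s : ℤ/(2N+1)ℤ → G, w₁ ∈ G, π ∈ G, μ ∈ G satisfy: w₁² = 1, μ² = 1, π·s_k·π⁻¹ = s_{k+1} for all k ∈ ℤ/(2N+1)ℤ, w₁·s_k·w₁⁻¹ = s_{2N−k+1} for all k ∈ ℤ/(2N+1)ℤ (indices read modulo 2N+1), π·w₁ = w₁·π⁻¹, μ·s₁ = s₁·μ, μ·w₁ = w₁·μ, and μ·π² = π²·μ. Define w₀ = π²·w₁, r = π·w₁, μ₀ = π⁻¹·μ·π and μ₁ = μ. Then: μ₀² = 1 and μ₁² = 1; μ_i·s_j = s_j·μ_i for every i ∈ {0,1} and every j ∈ ℤ/(2N+1)ℤ; μ_i·w_k = w_k·μ_i for every i, k ∈ {0,1}; r·μ₀ = μ₁·r; and r·μ₁ = μ₀·r. -/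
/-- Group-theoretic content of Lemma 3.2: the relations satisfied by
`μ₀ = π⁻¹μπ`, `μ₁ = μ` with the generators `s j`, `w₀ = π²w₁`, `w₁`
and the reflection `r = πw₁`. -/
theorem stmt_0 {G : Type*} [Group G] (N : ℕ) (hN : 0 < N)
    (s : ZMod (2 * N + 1) → G) (w₁ π μ : G)
    (hw₁ : w₁ ^ 2 = 1) (hμ : μ ^ 2 = 1)
    (hπs : ∀ k : ZMod (2 * N + 1), π * s k * π⁻¹ = s (k + 1))
    (hw₁s : ∀ k : ZMod (2 * N + 1), w₁ * s k * w₁⁻¹ = s (2 * (N : ZMod (2 * N + 1)) - k + 1))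
    (hπw₁ : π * w₁ = w₁ * π⁻¹)
    (hμs₁ : μ * s 1 = s 1 * μ)
    (hμw₁ : μ * w₁ = w₁ * μ)
    (hμπ : μ * π ^ 2 = π ^ 2 * μ) :
    ((π⁻¹ * μ * π) ^ 2 = 1 ∧ μ ^ 2 = 1) ∧
    (∀ j : ZMod (2 * N + 1),
      (π⁻¹ * μ * π) * s j = s j * (π⁻¹ * μ * π) ∧ μ * s j = s j * μ) ∧
    ((π⁻¹ * μ * π) * (π ^ 2 * w₁) = (π ^ 2 * w₁) * (π⁻¹ * μ * π) ∧
      (π⁻¹ * μ * π) * w₁ = w₁ * (π⁻¹ * μ * π) ∧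
      μ * (π ^ 2 * w₁) = (π ^ 2 * w₁) * μ ∧
      μ * w₁ = w₁ * μ) ∧
    ((π * w₁) * (π⁻¹ * μ * π) = μ * (π * w₁)) ∧
    ((π * w₁) * μ = (π⁻¹ * μ * π) * (π * w₁)) := by
  have h0 : π⁻¹ * μ * π = π * μ * π⁻¹ := by
    rw [eq_mul_inv_iff_mul_eq]
    calc π⁻¹ * μ * π * π = π⁻¹ * (μ * π ^ 2) := by simp only [pow_two, mul_assoc]
      _ = π⁻¹ * (π ^ 2 * μ) := by rw [hμπ]
      _ = π * μ := by group
  have hc : w₁ * π = π⁻¹ * w₁ := by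
    calc w₁ * π = π⁻¹ * (π * w₁) * π := by group
      _ = π⁻¹ * (w₁ * π⁻¹) * π := by rw [hπw₁]
      _ = π⁻¹ * w₁ := by group
  have hstep : ∀ m : ℕ, Commute μ (s (1 + 2 * (m : ZMod (2 * N + 1)))) := by
    intro m
    induction m with
    | zero => simpa using (show Commute μ (s 1) from hμs₁)
    | succ m ih =>
      have e : s (1 + 2 * ((m + 1 : ℕ) : ZMod (2 * N + 1)))
          = π ^ 2 * s (1 + 2 * (m : ZMod (2 * N + 1))) * (π ^ 2)⁻¹ := by
        have : (1 + 2 * ((m + 1 : ℕ) : ZMod (2 * N + 1)))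
          = 1 + 2 * (m : ZMod (2 * N + 1)) + 1 + 1 := by push_cast; ring
        rw [this, ← hπs, ← hπs]
        simp only [pow_two, mul_assoc, mul_inv_rev]
      rw [e]
      have hp : Commute μ (π ^ 2) := hμπ
      exact (hp.mul_right ih).mul_right hp.inv_right
  have hs : ∀ j, Commute μ (s j) := by
    intro j
    have h := hstep ((j - 1) * ((N : ZMod (2 * N + 1)) + 1)).val
    have z : (2 * (N : ZMod (2 * N + 1)) + 1) = 0 := by
      exact_mod_cast ZMod.natCast_self (2 * N + 1)
    rw [ZMod.natCast_zmod_val] at h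
    have : 1 + 2 * ((j - 1) * ((N : ZMod (2 * N + 1)) + 1)) = j := by
      linear_combination (j - 1) * z
    rwa [this] at h
  have hw : (π⁻¹ * μ * π) * w₁ = w₁ * (π⁻¹ * μ * π) := by
    calc (π⁻¹ * μ * π) * w₁ = π⁻¹ * μ * (π * w₁) := by group
      _ = π⁻¹ * (μ * w₁) * π⁻¹ := by rw [hπw₁]; group
      _ = (π⁻¹ * w₁) * μ * π⁻¹ := by rw [hμw₁]; group
      _ = w₁ * (π * μ * π⁻¹) := by rw [← hc]; group
      _ = _ := by rw [h0]
  have hp0 : Commute (π⁻¹ * μ * π) (π ^ 2) := by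
    change _ = _
    calc (π⁻¹ * μ * π) * π ^ 2 = π⁻¹ * (μ * π ^ 2) * π := by group
      _ = π⁻¹ * (π ^ 2 * μ) * π := by rw [hμπ]
      _ = _ := by group
  refine ⟨⟨?_, hμ⟩, fun j => ⟨?_, hs j⟩,
    ⟨hp0.mul_right hw, hw, Commute.mul_right hμπ hμw₁, hμw₁⟩, ?_, ?_⟩
  · calc (π⁻¹ * μ * π) ^ 2 = π⁻¹ * μ ^ 2 * π := by simp only [pow_two]; group
      _ = 1 := by rw [hμ]; group
  · have h : μ * (π * s j * π⁻¹) = (π * s j * π⁻¹) * μ := by rw [hπs]; exact hs _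
    calc (π⁻¹ * μ * π) * s j = π⁻¹ * (μ * (π * s j * π⁻¹)) * π := by group
      _ = π⁻¹ * ((π * s j * π⁻¹) * μ) * π := by rw [h]
      _ = _ := by group
  · rw [mul_assoc π, ← hw]; group
  · rw [h0, mul_assoc π, ← hμw₁]; group
end

section
/- Let G be a group, let N be a positive integer, and let s : ℤ/(2N+1)ℤ → G, w₁ ∈ G, π ∈ G satisfy: w₁² = 1, π·s_k·π⁻¹ = s_{k+1} for all k ∈ ℤ/(2N+1)ℤ, w₁·s_k·w₁⁻¹ = s_{2N−k+1} for all k ∈ ℤ/(2N+1)ℤ (indices read modulo 2N+1), and π·w₁ = w₁·π⁻¹. Define w₀ = π²·w₁ and r = π·w₁. Then: w₀² = 1; r² = 1; w₀·s_i = s_{2N−i+3}·w₀ for all i ∈ ℤ/(2N+1)ℤ; r·s_i = s_{2N−i+2}·r for all i ∈ ℤ/(2N+1)ℤ; r·w₀ = w₁·r; and r·w₁ = w₀·r. -/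
/-- Group-theoretic content of relations (3.7): `w₀ = π²w₁` and `r = πw₁`
satisfy the fundamental relations of `(⟨s⟩⋊⟨w₀,w₁⟩)⋊⟨r⟩`. -/
theorem stmt_1 {G : Type*} [Group G] (N : ℕ) (hN : 0 < N)
    (s : ZMod (2 * N + 1) → G) (w₁ π : G)
    (hw₁ : w₁ ^ 2 = 1)
    (hπs : ∀ k : ZMod (2 * N + 1), π * s k * π⁻¹ = s (k + 1))
    (hw₁s : ∀ k : ZMod (2 * N + 1), w₁ * s k * w₁⁻¹ = s (2 * (N : ZMod (2 * N + 1)) - k + 1))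
    (hπw₁ : π * w₁ = w₁ * π⁻¹) :
    (π ^ 2 * w₁) ^ 2 = 1 ∧
    (π * w₁) ^ 2 = 1 ∧
    (∀ i : ZMod (2 * N + 1),
      (π ^ 2 * w₁) * s i = s (2 * (N : ZMod (2 * N + 1)) - i + 3) * (π ^ 2 * w₁)) ∧
    (∀ i : ZMod (2 * N + 1),
      (π * w₁) * s i = s (2 * (N : ZMod (2 * N + 1)) - i + 2) * (π * w₁)) ∧
    ((π * w₁) * (π ^ 2 * w₁) = w₁ * (π * w₁)) ∧
    ((π * w₁) * w₁ = (π ^ 2 * w₁) * (π * w₁)) := by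
  have hww : w₁ * w₁ = 1 := by rw [← pow_two]; exact hw₁
  have hA : π * w₁ * π = w₁ := by rw [hπw₁]; group
  have hP : ∀ k, π * s k = s (k + 1) * π := fun k => by rw [← hπs k]; group
  have hW : ∀ k, w₁ * s k = s (2 * (N : ZMod (2 * N + 1)) - k + 1) * w₁ :=
    fun k => by rw [← hw₁s k]; group
  have hR : ∀ i : ZMod (2 * N + 1),
      (π * w₁) * s i = s (2 * (N : ZMod (2 * N + 1)) - i + 2) * (π * w₁) := by
    intro i
    rw [mul_assoc, hW, ← mul_assoc, hP, mul_assoc]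
    congr 2
    ring
  refine ⟨?_, ?_, ?_, hR, ?_, ?_⟩
  · calc (π ^ 2 * w₁) ^ 2 = π * (π * w₁ * π) * π * w₁ := by simp only [pow_two, mul_assoc]
      _ = 1 := by rw [hA, hA, hww]
  · calc (π * w₁) ^ 2 = (π * w₁ * π) * w₁ := by simp only [pow_two, mul_assoc]
      _ = 1 := by rw [hA, hww]
  · intro i
    rw [pow_two, mul_assoc π π w₁, mul_assoc π (π * w₁), hR, ← mul_assoc, hP, mul_assoc]
    congr 2
    ring
  · calc (π * w₁) * (π ^ 2 * w₁) = (π * w₁ * π) * (π * w₁) := by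
          simp only [pow_two, mul_assoc]
      _ = w₁ * (π * w₁) := by rw [hA]
  · calc (π * w₁) * w₁ = π * (π * w₁ * π) * w₁ := by rw [hA]
      _ = (π ^ 2 * w₁) * (π * w₁) := by simp only [pow_two, mul_assoc]
end

section
/- For every l ∈ ℤ the function f satisfies the 2N-th order q-difference equation: f(l+2N+1)·f(l+1)·(∏_{k=1}^{N−1} f(l+2k+1)) + ζ_l⁴·(∏_{k=1}^{N} f(l+2k)) = −q^{l+2N}·a_l·b·ζ_l³ / (∏_{k=1}^{2N−1} a_{l+k}^{2N−k}), where an empty product equals 1. (Taking ζ = c this is equation (2.13) of the paper for f, and taking ζ = ε/c it is equation (2.14) for g; this is Lemma 2.2.) -/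
open Finset

theorem tele_aux (U f : ℤ → ℂ) (hU : ∀ l, U l ≠ 0)
    (hf : ∀ l : ℤ, f l = U (l - 1) / U (l + 1)) (m : ℤ) (n : ℕ) :
    ∏ k ∈ Finset.range n, f (m + 2 * ((k : ℤ) + 1)) = U (m + 1) / U (m + 1 + 2 * (n : ℤ)) := by
  induction n with
  | zero => simp [hU]
  | succ n ih =>
    rw [Finset.prod_range_succ, ih, hf]
    have h1 : m + 2 * ((n : ℤ) + 1) - 1 = m + 1 + 2 * (n : ℤ) := by ring
    have h2 : m + 2 * ((n : ℤ) + 1) + 1 = m + 1 + 2 * ((n + 1 : ℕ) : ℤ) := by push_cast; ring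
    rw [h1, h2, div_mul_div_cancel₀ (hU _)]

/-- Lemma 2.2: the variable `f(l) = U(l-1)/U(l+1)` satisfies a `2N`-th order
`q`-difference equation. -/
theorem stmt_2 (N : ℕ) (hN : 0 < N)
    (a : ℤ → ℂ) (ha : ∀ i, a i ≠ 0) (hap : ∀ i : ℤ, a (i + (2 * (N : ℤ) + 1)) = a i)
    (b q ζ : ℂ) (hb : b ≠ 0) (hq : q ≠ 0) (hζ : ζ ≠ 0)
    (ζl : ℤ → ℂ) (hζl : ∀ l : ℤ, ζl l = if Even l then ζ else ζ⁻¹)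
    (U : ℤ → ℂ) (hU : ∀ l, U l ≠ 0)
    (hUeq : ∀ l : ℤ,
      U l / U (l + (2 * (N : ℤ) + 2)) + (ζl l) ^ 4 * U (l + 1) / U (l + (2 * (N : ℤ) + 1))
        + (q ^ (l + 2 * (N : ℤ)) * a l * b
            / ∏ k ∈ Finset.range (2 * N - 1), (a (l + (k : ℤ) + 1)) ^ (2 * N - (k + 1)))
          * (ζl l) ^ 3 = 0)
    (f : ℤ → ℂ) (hf : ∀ l : ℤ, f l = U (l - 1) / U (l + 1)) :
    ∀ l : ℤ,
      f (l + (2 * (N : ℤ) + 1)) * f (l + 1)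
          * (∏ k ∈ Finset.range (N - 1), f (l + 2 * ((k : ℤ) + 1) + 1))
        + (ζl l) ^ 4 * (∏ k ∈ Finset.range N, f (l + 2 * ((k : ℤ) + 1)))
      = -(q ^ (l + 2 * (N : ℤ)) * a l * b * (ζl l) ^ 3
            / ∏ k ∈ Finset.range (2 * N - 1), (a (l + (k : ℤ) + 1)) ^ (2 * N - (k + 1))) := by
  intro l
  have e := hUeq l
  have t2 := tele_aux U f hU hf l N
  obtain ⟨M, rfl⟩ : ∃ M, N = M + 1 := ⟨N - 1, by omega⟩
  have t1 := tele_aux U f hU hf (l + 1) M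
  have t1' : ∏ k ∈ Finset.range (M + 1 - 1), f (l + 2 * ((k : ℤ) + 1) + 1)
      = U (l + 2) / U (l + 2 * ((M + 1 : ℕ) : ℤ)) := by
    rw [Nat.add_sub_cancel]
    convert t1 using 2
    · congr 1; ring
    · congr 1; ring
    · congr 1; push_cast; ring
  have g1 : f (l + (2 * ((M + 1 : ℕ) : ℤ) + 1))
      = U (l + 2 * ((M + 1 : ℕ) : ℤ)) / U (l + (2 * ((M + 1 : ℕ) : ℤ) + 2)) := by
    rw [hf]; congr 2 <;> ring
  have g2 : f (l + 1) = U l / U (l + 2) := by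
    rw [hf]; congr 2 <;> ring
  have g3 : l + 1 + 2 * ((M + 1 : ℕ) : ℤ) = l + (2 * ((M + 1 : ℕ) : ℤ) + 1) := by ring
  rw [g3] at t2
  rw [t1', t2, g1, g2]
  have c : U (l + 2 * ((M + 1 : ℕ) : ℤ)) / U (l + (2 * ((M + 1 : ℕ) : ℤ) + 2)) *
      (U l / U (l + 2)) * (U (l + 2) / U (l + 2 * ((M + 1 : ℕ) : ℤ)))
      = U l / U (l + (2 * ((M + 1 : ℕ) : ℤ) + 2)) := by
    have h1 := hU (l + 2 * ((M + 1 : ℕ) : ℤ))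
    have h2 := hU (l + 2)
    have h3 := hU (l + (2 * ((M + 1 : ℕ) : ℤ) + 2))
    generalize U (l + 2 * ((M + 1 : ℕ) : ℤ)) = x at *
    generalize U (l + (2 * ((M + 1 : ℕ) : ℤ) + 2)) = y at *
    generalize U (l + 2) = z at *
    field_simp
  rw [c]
  rw [mul_div_assoc, div_mul_eq_mul_div] at e
  linear_combination e
end

section
/- Assume all denominators occurring below are nonzero. Then (equation (2.13a) of Lemma 2.3): (1 − f₁/(a₁^{2N+1}c²))·(f₁ − ε^{2N−3}c^{6−4N}g₁)/(f₁ − q^{2N+1}ε^{2N−3}c⁴g₁) + Σ_{k=1}^{N−1} [(∏_{i=1}^{k} f_{2i−1}) / ((∏_{i=1}^{2k} a_i^{2N+1})·c^{4k}·(∏_{i=1}^{k} f_{2i}))]·(1 − f_{2k+1}/(a_{2k+1}^{2N+1}c²)) + [a₀^{2N+1}/(q^{2N+1}·c^{4N}·∏_{i=1}^{N} f_{2i})]·( q^{2N}·b·c/∏_{i=0}^{2N−1} a_i^{2N−i} + ∏_{i=1}^{N} f_{2i−1} ) = 0, where an empty sum equals 0 and an empty product equals 1. -/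
open Finset

/-- Equation (2.13a) of Lemma 2.3. -/
theorem stmt_3 (N : ℕ) (hN : 1 ≤ N)
    (γ δ : ℂ) (hγ : γ ≠ 0) (hδ : δ ≠ 0) (hγδ : γ ≠ δ)
    (α : ℤ → ℂ) (hα : ∀ l, α l ≠ 0) (β₀ : ℂ) (hβ₀ : β₀ ≠ 0)
    (U V : ℤ → ℂ) (hU : ∀ l, U l ≠ 0) (hV : ∀ l, V l ≠ 0)
    (hR3 : ∀ l : ℤ,
      U (2 * l + 1) / V (2 * l + 2 * (N : ℤ) + 2) = V (2 * l + 1) / U (2 * l + 2 * (N : ℤ) + 2))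
    (hR4 : ∀ l : ℤ,
      U (2 * l) / V (2 * l + 2 * (N : ℤ) + 1)
        - γ ^ 4 * V (2 * l) / (δ ^ 4 * U (2 * l + 2 * (N : ℤ) + 1))
        - β₀ * γ ^ 4 * (γ - δ) / (γ * δ) ^ (2 * (l + (N : ℤ))) = 0)
    (hR5 : ∀ l : ℤ,
      U (2 * l) / V (2 * l + 1) - γ ^ 3 * V (2 * l) / (δ ^ 3 * U (2 * l + 1))
        + γ ^ 3 * (γ - δ) / ((γ * δ) ^ (2 * l) * α (2 * l)) = 0)
    (hR6 : ∀ l : ℤ,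
      U (2 * l + 2) / V (2 * l + 1) - γ * V (2 * l + 2) / (δ * U (2 * l + 1))
        + γ * (γ - δ) / ((γ * δ) ^ (2 * l) * α (2 * l + 1)) = 0)
    (a : ℤ → ℂ) (haz : ∀ i, a i ≠ 0)
    (hap : ∀ i : ℤ, a (i + (2 * (N : ℤ) + 1)) = a i)
    (haα : ∀ i : ℤ, α i = a i ^ (2 * N + 1) * α (i - 1))
    (b c q : ℂ) (hb : b ≠ 0) (hc : c ≠ 0) (hq : q ≠ 0)
    (hcγ : c = γ) (hδc : δ = (γ * δ) / c)
    (hqε : q ^ (2 * N + 1) * (γ * δ) ^ (2 * N - 1) = 1)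
    (hprod : ∏ i ∈ Finset.range (2 * N + 1), a (i : ℤ) = q)
    (hαβ : α (2 * (N : ℤ)) * β₀
      = q ^ (2 * N) * b / ∏ i ∈ Finset.range (2 * N), a (i : ℤ) ^ (2 * N - i))
    (f g : ℤ → ℂ)
    (hf : ∀ i : ℤ, f i = U (i - 1) / U (i + 1))
    (hg : ∀ i : ℤ, g i = V (i - 1) / V (i + 1))
    (hden : f 1 - q ^ (2 * N + 1) * (γ * δ) ^ (2 * (N : ℤ) - 3) * c ^ 4 * g 1 ≠ 0) :
    (1 - f 1 / (a 1 ^ (2 * N + 1) * c ^ 2)) *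
        ((f 1 - (γ * δ) ^ (2 * (N : ℤ) - 3) * c ^ (6 - 4 * (N : ℤ)) * g 1)
          / (f 1 - q ^ (2 * N + 1) * (γ * δ) ^ (2 * (N : ℤ) - 3) * c ^ 4 * g 1))
      + (∑ k ∈ Finset.range (N - 1),
          ((∏ i ∈ Finset.range (k + 1), f (2 * (i : ℤ) + 1))
            / ((∏ i ∈ Finset.range (2 * (k + 1)), a ((i : ℤ) + 1) ^ (2 * N + 1))
                * c ^ (4 * (k + 1))
                * ∏ i ∈ Finset.range (k + 1), f (2 * (i : ℤ) + 2))
            * (1 - f (2 * ((k : ℤ) + 1) + 1)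
                / (a (2 * ((k : ℤ) + 1) + 1) ^ (2 * N + 1) * c ^ 2))))
      + (a 0 ^ (2 * N + 1)
            / (q ^ (2 * N + 1) * c ^ (4 * N) * ∏ i ∈ Finset.range N, f (2 * (i : ℤ) + 2)))
          * (q ^ (2 * N) * b * c / (∏ i ∈ Finset.range (2 * N), a (i : ℤ) ^ (2 * N - i))
              + ∏ i ∈ Finset.range N, f (2 * (i : ℤ) + 1))
      = 0 := by
  obtain ⟨n, rfl⟩ : ∃ n, N = n + 1 := ⟨N - 1, by omega⟩
  subst hcγ
  clear hR3 hδc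
  obtain ⟨r, rfl⟩ : ∃ r, δ = r * c := ⟨δ / c, by field_simp⟩
  have hr : r ≠ 0 := left_ne_zero_of_mul hδ
  have hr1 : (1 - r) ≠ 0 := by
    intro h
    apply hγδ
    have : r = 1 := by linear_combination -h
    rw [this, one_mul]
  have hcc : c - r * c ≠ 0 := sub_ne_zero.mpr hγδ
  -- the key relations
  have k5 : ∀ k : ℕ, U (2 * k + 1) / (U (2 * k) * α (2 * k) * c ^ (4 * k))
      = r ^ (2 * k) / (c ^ 3 * (c - r * c)) *
        ((V (2 * k) / U (2 * k)) / r ^ 3 - U (2 * k + 1) / V (2 * k + 1)) := by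
    intro k
    have h := hR5 k
    have e : (c * (r * c)) ^ (2 * (k : ℤ)) = r ^ (2 * k) * c ^ (4 * k) := by
      rw [show (2 * (k : ℤ)) = ((2 * k : ℕ) : ℤ) by push_cast; ring, zpow_natCast]
      ring
    rw [e] at h
    have := hU (2 * k); have := hU (2 * k + 1); have := hV (2 * k + 1); have := hα (2 * k)
    generalize U (2 * k) = u0 at *
    generalize U (2 * k + 1) = u1 at *
    generalize V (2 * k) = v0 at *
    generalize V (2 * k + 1) = v1 at *
    generalize α (2 * k) = al at *
    have hX : r ^ (2 * k) ≠ 0 := pow_ne_zero _ hr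
    have hY : c ^ (4 * k) ≠ 0 := pow_ne_zero _ hc
    generalize r ^ (2 * k) = X at *
    generalize c ^ (4 * k) = Y at *
    have e2 : u1 / u0 * (X / (c ^ 3 * (c - r * c))) * (u0 / v1 - c ^ 3 * v0 / ((r * c) ^ 3 * u1) + c ^ 3 * (c - r * c) / (X * Y * al)) = 0 := by rw [h, mul_zero]
    rw [← sub_eq_zero, ← e2]
    field_simp
    ring
  have k6 : ∀ k : ℕ, U (2 * k + 1) / (U (2 * k + 2) * α (2 * k + 1) * c ^ (4 * k + 2))
      = r ^ (2 * k) / (c ^ 3 * (c - r * c)) *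
        ((V (2 * k + 2) / U (2 * k + 2)) / r - U (2 * k + 1) / V (2 * k + 1)) := by
    intro k
    have h := hR6 k
    have e : (c * (r * c)) ^ (2 * (k : ℤ)) = r ^ (2 * k) * c ^ (4 * k) := by
      rw [show (2 * (k : ℤ)) = ((2 * k : ℕ) : ℤ) by push_cast; ring, zpow_natCast]
      ring
    rw [e] at h
    rw [pow_add]
    have := hU (2 * k + 2); have := hU (2 * k + 1); have := hV (2 * k + 1); have := hα (2 * k + 1)
    generalize U (2 * k + 2) = u0 at *
    generalize U (2 * k + 1) = u1 at *
    generalize V (2 * k + 2) = v0 at *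
    generalize V (2 * k + 1) = v1 at *
    generalize α (2 * k + 1) = al at *
    have hX : r ^ (2 * k) ≠ 0 := pow_ne_zero _ hr
    have hY : c ^ (4 * k) ≠ 0 := pow_ne_zero _ hc
    generalize r ^ (2 * k) = X at *
    generalize c ^ (4 * k) = Y at *
    have e2 : u1 / u0 * (X / (c ^ 3 * (c - r * c))) * (u0 / v1 - c * v0 / ((r * c) * u1) + c * (c - r * c) / (X * Y * al)) = 0 := by rw [h, mul_zero]
    rw [← sub_eq_zero, ← e2]
    field_simp
    ring
  have po : ∀ k : ℕ, ∏ i ∈ Finset.range k, f (2 * (i : ℤ) + 1) = U 0 / U (2 * k) := by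
    intro k
    induction k with
    | zero => simp [hU]
    | succ k ih =>
      rw [Finset.prod_range_succ, ih, hf]
      rw [show (2 * (k : ℤ) + 1 - 1) = 2 * k by ring,
        show (2 * (k : ℤ) + 1 + 1) = 2 * ((k + 1 : ℕ) : ℤ) by push_cast; ring]
      have := hU (2 * k)
      field_simp
  have pe : ∀ k : ℕ, ∏ i ∈ Finset.range k, f (2 * (i : ℤ) + 2) = U 1 / U (2 * k + 1) := by
    intro k
    induction k with
    | zero => simp [hU]
    | succ k ih =>
      rw [Finset.prod_range_succ, ih, hf]
      rw [show (2 * (k : ℤ) + 2 - 1) = 2 * k + 1 by ring,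
        show (2 * (k : ℤ) + 2 + 1) = 2 * ((k + 1 : ℕ) : ℤ) + 1 by push_cast; ring]
      have := hU (2 * k + 1)
      field_simp
  have pa : ∀ (j : ℤ) (k : ℕ), ∏ i ∈ Finset.range k, a ((i : ℤ) + j) ^ (2 * (n + 1) + 1)
      = α (k + j - 1) / α (j - 1) := by
    intro j k
    induction k with
    | zero => simp [hα]
    | succ k ih =>
      rw [Finset.prod_range_succ, ih]
      have h := haα (k + j)
      rw [show ((k + 1 : ℕ) : ℤ) + j - 1 = k + j by push_cast; ring, h]
      ring
  have tele : ∀ k : ℕ, U 0 / U (2 * k) / (α (2 * k) / α 0 * c ^ (4 * k) * (U 1 / U (2 * k + 1)))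
      * (1 - U (2 * k) / U (2 * k + 2) / (α (2 * k + 1) / α (2 * k) * c ^ 2))
      = U 0 * α 0 / U 1 / (c ^ 3 * (c - r * c)) * r ^ (2 * k) *
        ((V (2 * k) / U (2 * k)) / r ^ 3 - (V (2 * k + 2) / U (2 * k + 2)) / r) := by
    intro k
    have h5 := k5 k
    have h6 := k6 k
    have e : U 0 / U (2 * k) / (α (2 * k) / α 0 * c ^ (4 * k) * (U 1 / U (2 * k + 1)))
      * (1 - U (2 * k) / U (2 * k + 2) / (α (2 * k + 1) / α (2 * k) * c ^ 2))
      = U 0 * α 0 / U 1 * (U (2 * k + 1) / (U (2 * k) * α (2 * k) * c ^ (4 * k))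
        - U (2 * k + 1) / (U (2 * k + 2) * α (2 * k + 1) * c ^ (4 * k + 2))) := by
      have := hU (2 * k + 2); have := hU (2 * k + 1); have := hU (2 * k)
      have := hα (2 * k); have := hα (2 * k + 1); have := hU 0; have := hU 1; have := hα 0
      rw [pow_add]
      have hY : c ^ (4 * k) ≠ 0 := pow_ne_zero _ hc
      generalize c ^ (4 * k) = Y at *
      field_simp
    rw [e, h5, h6]
    ring
  have fodd : ∀ k : ℕ, f (2 * (k : ℤ) + 1) = U (2 * k) / U (2 * k + 2) := by
    intro k
    rw [hf, show (2 * (k : ℤ) + 1 - 1) = 2 * k by ring,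
        show (2 * (k : ℤ) + 1 + 1) = 2 * k + 2 by ring]
  have aodd : ∀ k : ℕ, a (2 * (k : ℤ) + 1) ^ (2 * (n + 1) + 1) = α (2 * k + 1) / α (2 * k) := by
    intro k
    have h := haα (2 * k + 1)
    rw [show (2 * (k : ℤ) + 1 - 1) = 2 * k by ring] at h
    rw [h]
    have := hα (2 * k)
    field_simp
  have hsum : ∀ m : ℕ, (∑ k ∈ Finset.range m,
          ((∏ i ∈ Finset.range (k + 1), f (2 * (i : ℤ) + 1))
            / ((∏ i ∈ Finset.range (2 * (k + 1)), a ((i : ℤ) + 1) ^ (2 * (n + 1) + 1))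
                * c ^ (4 * (k + 1))
                * ∏ i ∈ Finset.range (k + 1), f (2 * (i : ℤ) + 2))
            * (1 - f (2 * ((k : ℤ) + 1) + 1)
                / (a (2 * ((k : ℤ) + 1) + 1) ^ (2 * (n + 1) + 1) * c ^ 2))))
      = U 0 * α 0 / U 1 / (c ^ 3 * (c - r * c)) *
        ((V 2 / U 2) / r - r ^ (2 * m) * (V (2 * m + 2) / U (2 * m + 2)) / r) := by
    intro m
    induction m with
    | zero => simp
    | succ m ih =>
      rw [Finset.sum_range_succ, ih]
      have h := tele (m + 1)
      have h1 := fodd (m + 1)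
      have h2 := aodd (m + 1)
      have h3 := pa 1 (2 * (m + 1))
      rw [po, pe, h3]
      rw [show ((2 * (m + 1) : ℕ) : ℤ) + 1 - 1 = 2 * ((m + 1 : ℕ) : ℤ) by push_cast; ring,
        show (1 : ℤ) - 1 = 0 by ring]
      rw [show (m : ℤ) + 1 = ((m + 1 : ℕ) : ℤ) by push_cast; ring, h1, h2, h]
      rw [show 2 * (m : ℤ) + 2 = 2 * ((m + 1 : ℕ) : ℤ) by push_cast; ring]
      have e : r ^ (2 * (m + 1)) * ((V (2 * ((m + 1 : ℕ) : ℤ)) / U (2 * ((m + 1 : ℕ) : ℤ))) / r ^ 3)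
          = r ^ (2 * m) * (V (2 * ((m + 1 : ℕ) : ℤ)) / U (2 * ((m + 1 : ℕ) : ℤ))) / r := by
        rw [show 2 * (m + 1) = 2 * m + 2 by ring, pow_add]
        field_simp
      linear_combination (U 0 * α 0 / U 1 / (c ^ 3 * (c - r * c))) * e
  -- the first term
  have eps1 : (c * (r * c)) ^ (2 * ((n + 1 : ℕ) : ℤ) - 3) * c ^ (6 - 4 * ((n + 1 : ℕ) : ℤ))
      = r ^ (2 * n) / r := by
    have e1 : (2 * ((n + 1 : ℕ) : ℤ) - 3) = ((2 * n : ℕ) : ℤ) - 1 := by push_cast; ring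
    have e2 : (6 - 4 * ((n + 1 : ℕ) : ℤ)) = 2 - ((4 * n : ℕ) : ℤ) := by push_cast; ring
    have h0 : c * (r * c) ≠ 0 := mul_ne_zero hγ hδ
    rw [e1, e2, zpow_sub₀ h0, zpow_sub₀ hc, zpow_natCast, zpow_natCast, zpow_one]
    rw [show (4 * n) = 2 * (2 * n) by ring, pow_mul c 2, mul_pow, mul_pow]
    rw [show c ^ (2 : ℤ) = c ^ 2 by norm_cast]
    rw [← pow_mul, mul_comm 2 (2 * n), pow_mul]
    have := pow_ne_zero (2 * n) hc
    field_simp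
    ring
  have eps2 : q ^ (2 * (n + 1) + 1) * (c * (r * c)) ^ (2 * ((n + 1 : ℕ) : ℤ) - 3) * c ^ 4
      = 1 / r ^ 2 := by
    have h0 : c * (r * c) ≠ 0 := mul_ne_zero hγ hδ
    have e1 : (2 * ((n + 1 : ℕ) : ℤ) - 3) = ((2 * (n + 1) - 1 : ℕ) : ℤ) - 2 := by
      have : 2 * (n + 1) - 1 = 2 * n + 1 := by omega
      rw [this]; push_cast; ring
    rw [e1, zpow_sub₀ h0, zpow_natCast, ← mul_div_assoc, hqε]
    rw [show (c * (r * c)) ^ (2 : ℤ) = (c * (r * c)) ^ 2 by norm_cast]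
    field_simp
  rw [eps2] at hden
  rw [eps2, eps1]
  have t0 := tele 0
  have f0 : f 1 = U 0 / U 2 := by simpa using fodd 0
  have a0 : a 1 ^ (2 * (n + 1) + 1) = α 1 / α 0 := by simpa using aodd 0
  have g0 : g 1 = V 0 / V 2 := by rw [hg]; norm_num
  have T1 : (1 - f 1 / (a 1 ^ (2 * (n + 1) + 1) * c ^ 2)) *
      ((f 1 - r ^ (2 * n) / r * g 1) / (f 1 - 1 / r ^ 2 * g 1))
      = - (U 0 * α 0 / U 1 / (c ^ 3 * (c - r * c))) / r *
        (V 2 / U 2 - r ^ (2 * n) / r * (V 0 / U 0)) := by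
    have t1 : (1 - f 1 / (a 1 ^ (2 * (n + 1) + 1) * c ^ 2)) =
        U 0 * α 0 / U 1 / (c ^ 3 * (c - r * c)) * (V 0 / U 0 / r ^ 3 - V 2 / U 2 / r) := by
      rw [f0, a0]
      have := hU 0; have := hU 1; have := hα 0
      simp at t0
      rw [← t0]
      field_simp
    have t2 : V 0 / U 0 / r ^ 3 - V 2 / U 2 / r =
        - (V 2 / U 0 / r) * (f 1 - 1 / r ^ 2 * g 1) := by
      rw [f0, g0]
      have := hU 0; have := hU 2; have := hV 2
      field_simp
      ring
    have t3 : V 2 / U 2 - r ^ (2 * n) / r * (V 0 / U 0) =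
        V 2 / U 0 * (f 1 - r ^ (2 * n) / r * g 1) := by
      rw [f0, g0]
      have := hU 0; have := hU 2; have := hV 2
      field_simp
    rw [t1, t2, t3]
    generalize f 1 - 1 / r ^ 2 * g 1 = D at *
    generalize U 0 * α 0 / U 1 / (c ^ 3 * (c - r * c)) = M
    have := hU 0
    field_simp
  have hS := hsum n
  have hn : n + 1 - 1 = n := rfl
  have hqa : a 0 ^ (2 * (n + 1) + 1) / q ^ (2 * (n + 1) + 1) = α 0 / α (2 * ((n + 1 : ℕ) : ℤ)) := by
    have h := pa 0 (2 * (n + 1) + 1)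
    simp only [add_zero] at h
    rw [Finset.prod_pow, hprod] at h
    rw [h, show ((2 * (n + 1) + 1 : ℕ) : ℤ) - 1 = 2 * ((n + 1 : ℕ) : ℤ) by push_cast; ring]
    have h0 := haα 0
    have := hα (0 - 1)
    have := hα (2 * ((n + 1 : ℕ) : ℤ))
    rw [h0]
    field_simp
  have k4 : β₀ * c * U (2 * ((n + 1 : ℕ) : ℤ) + 1) / U 0 / c ^ (4 * (n + 1))
      = r ^ (2 * (n + 1)) / (c ^ 3 * (c - r * c)) *
        (U (2 * ((n + 1 : ℕ) : ℤ) + 1) / V (2 * ((n + 1 : ℕ) : ℤ) + 1) - V 0 / U 0 / r ^ 4) := by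
    have h := hR4 0
    have e : (c * (r * c)) ^ (2 * (0 + ((n + 1 : ℕ) : ℤ))) = r ^ (2 * (n + 1)) * c ^ (4 * (n + 1)) := by
      rw [show (2 * (0 + ((n + 1 : ℕ) : ℤ))) = ((2 * (n + 1) : ℕ) : ℤ) by push_cast; ring, zpow_natCast]
      ring
    rw [e, show (2 * (0 : ℤ)) = 0 by ring, zero_add] at h
    have := hU 0; have := hU (2 * ((n + 1 : ℕ) : ℤ) + 1); have := hV (2 * ((n + 1 : ℕ) : ℤ) + 1)
    generalize U (2 * ((n + 1 : ℕ) : ℤ) + 1) = u1 at *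
    generalize V (2 * ((n + 1 : ℕ) : ℤ) + 1) = v1 at *
    generalize U 0 = u0 at *
    generalize V 0 = v0 at *
    have hX : r ^ (2 * (n + 1)) ≠ 0 := pow_ne_zero _ hr
    have hY : c ^ (4 * (n + 1)) ≠ 0 := pow_ne_zero _ hc
    generalize r ^ (2 * (n + 1)) = X at *
    generalize c ^ (4 * (n + 1)) = Y at *
    have e2 : - (u1 / u0) * (X / (c ^ 3 * (c - r * c))) * (u0 / v1 - c ^ 4 * v0 / ((r * c) ^ 4 * u1) - β₀ * c ^ 4 * (c - r * c) / (X * Y)) = 0 := by rw [h, mul_zero]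
    rw [← sub_eq_zero, ← e2]
    field_simp
    ring
  have hb2 : q ^ (2 * (n + 1)) * b * c / (∏ i ∈ Finset.range (2 * (n + 1)), a (i : ℤ) ^ (2 * (n + 1) - i))
      = α (2 * ((n + 1 : ℕ) : ℤ)) * β₀ * c := by
    rw [hαβ]; ring
  have T3 : a 0 ^ (2 * (n + 1) + 1) / (q ^ (2 * (n + 1) + 1) * c ^ (4 * (n + 1))
        * (U 1 / U (2 * ((n + 1 : ℕ) : ℤ) + 1)))
        * (α (2 * ((n + 1 : ℕ) : ℤ)) * β₀ * c + U 0 / U (2 * ((n + 1 : ℕ) : ℤ)))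
      = U 0 * α 0 / U 1 / (c ^ 3 * (c - r * c)) * r ^ (2 * (n + 1)) *
        (V (2 * ((n + 1 : ℕ) : ℤ)) / U (2 * ((n + 1 : ℕ) : ℤ)) / r ^ 3 - V 0 / U 0 / r ^ 4) := by
    have h5 := k5 (n + 1)
    have e : a 0 ^ (2 * (n + 1) + 1) / (q ^ (2 * (n + 1) + 1) * c ^ (4 * (n + 1))
        * (U 1 / U (2 * ((n + 1 : ℕ) : ℤ) + 1)))
        * (α (2 * ((n + 1 : ℕ) : ℤ)) * β₀ * c + U 0 / U (2 * ((n + 1 : ℕ) : ℤ)))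
        = U 0 * α 0 / U 1 * (β₀ * c * U (2 * ((n + 1 : ℕ) : ℤ) + 1) / U 0 / c ^ (4 * (n + 1))
          + U (2 * ((n + 1 : ℕ) : ℤ) + 1) / (U (2 * ((n + 1 : ℕ) : ℤ)) * α (2 * ((n + 1 : ℕ) : ℤ)) * c ^ (4 * (n + 1)))) := by
      rw [mul_assoc (q ^ _), ← div_div (a 0 ^ _), hqa]
      have := hU 0; have := hU 1; have := hU (2 * ((n + 1 : ℕ) : ℤ) + 1)
      have := hU (2 * ((n + 1 : ℕ) : ℤ)); have := hα (2 * ((n + 1 : ℕ) : ℤ))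
      have hY : c ^ (4 * (n + 1)) ≠ 0 := pow_ne_zero _ hc
      generalize c ^ (4 * (n + 1)) = Y at *
      generalize U (2 * ((n + 1 : ℕ) : ℤ) + 1) = u1 at *
      generalize U (2 * ((n + 1 : ℕ) : ℤ)) = u2 at *
      generalize α (2 * ((n + 1 : ℕ) : ℤ)) = al at *
      field_simp
    rw [e, k4, h5]
    ring
  rw [T1, hn, hS, hb2, po, pe, T3]
  rw [show 2 * (n : ℤ) + 2 = 2 * ((n + 1 : ℕ) : ℤ) by push_cast; ring]
  rw [show 2 * (n + 1) = 2 * n + 2 by ring, pow_add]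
  generalize V (2 * ((n + 1 : ℕ) : ℤ)) / U (2 * ((n + 1 : ℕ) : ℤ)) = w
  generalize U 0 * α 0 / U 1 / (c ^ 3 * (c - r * c)) = M
  generalize V 0 / U 0 = w0
  generalize V 2 / U 2 = w2
  generalize r ^ (2 * n) = X
  field_simp
  ring
end

section
/- Assume N ≥ 2. For every integer l₁ with 0 ≤ l₁ ≤ N−2 the following identity holds (equation (2.13b) of Lemma 2.3, written with denominators cleared): g_{2l₁+3}·(ε²f_{2l₁+1} − c⁴g_{2l₁+1})·(a_{2l₁+3}^{2N+1}c² − f_{2l₁+3}) = ε²·a_{2l₁+2}^{2N+1}·a_{2l₁+3}^{2N+1}·f_{2l₁+2}·(ε²f_{2l₁+3} − c⁴g_{2l₁+3})·(a_{2l₁+1}^{2N+1}c² − f_{2l₁+1}). -/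
open Finset

theorem aux_key (γ δ A E α0 u0 u1 u2 v0 v1 v2 : ℂ) (hγ : γ ≠ 0) (hδ : δ ≠ 0)
    (hE : E ≠ 0) (hA : A ≠ 0) (hα : α0 ≠ 0) (hu1 : u1 ≠ 0) (hu2 : u2 ≠ 0)
    (hv1 : v1 ≠ 0) (hv2 : v2 ≠ 0)
    (h5 : u0 / v1 - γ ^ 3 * v0 / (δ ^ 3 * u1) + γ ^ 3 * (γ - δ) / (E * α0) = 0)
    (h6 : u2 / v1 - γ * v2 / (δ * u1) + γ * (γ - δ) / (E * (A * α0)) = 0) :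
    (γ * δ) ^ 2 * (u0 / u2) - γ ^ 4 * (v0 / v2)
      = - (γ * δ ^ 3) * (γ * (γ - δ) / (E * (A * α0))) * (u1 / v2) * (A * γ ^ 2 - u0 / u2) := by
  have e5 : u0 / v1 = γ ^ 3 * v0 / (δ ^ 3 * u1) - γ ^ 3 * (γ - δ) / (E * α0) := by
    linear_combination h5
  have key : γ ^ 3 * v0 / (δ ^ 3 * u1) - γ ^ 3 * (γ - δ) / (E * α0)
      = (u0 / u2) * (γ * v2 / (δ * u1) - γ * (γ - δ) / (E * (A * α0))) := by
    rw [← e5]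
    have e6 : γ * v2 / (δ * u1) - γ * (γ - δ) / (E * (A * α0)) = u2 / v1 := by
      linear_combination -h6
    rw [e6]; field_simp
  have h : γ * δ ^ 3 * (u1 / v2) * (γ ^ 3 * v0 / (δ ^ 3 * u1)) = γ ^ 4 * (v0 / v2) := by
    field_simp
  have h' : γ * δ ^ 3 * (u1 / v2) * (γ * v2 / (δ * u1)) = (γ * δ) ^ 2 := by
    field_simp
  have h'' : γ ^ 3 * (γ - δ) / (E * α0) = γ * (γ - δ) / (E * (A * α0)) * (A * γ ^ 2) := by
    field_simp
  rw [h''] at key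
  linear_combination (-γ * δ ^ 3 * (u1 / v2)) * key + h - (u0 / u2) * h'

/-- Equation (2.13b) of Lemma 2.3, with denominators cleared. -/
theorem stmt_4 (N : ℕ) (hN : 1 ≤ N) (hN2 : 2 ≤ N)
    (γ δ : ℂ) (hγ : γ ≠ 0) (hδ : δ ≠ 0) (hγδ : γ ≠ δ)
    (α : ℤ → ℂ) (hα : ∀ l, α l ≠ 0) (β₀ : ℂ) (hβ₀ : β₀ ≠ 0)
    (U V : ℤ → ℂ) (hU : ∀ l, U l ≠ 0) (hV : ∀ l, V l ≠ 0)
    (hR3 : ∀ l : ℤ,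
      U (2 * l + 1) / V (2 * l + 2 * (N : ℤ) + 2) = V (2 * l + 1) / U (2 * l + 2 * (N : ℤ) + 2))
    (hR4 : ∀ l : ℤ,
      U (2 * l) / V (2 * l + 2 * (N : ℤ) + 1)
        - γ ^ 4 * V (2 * l) / (δ ^ 4 * U (2 * l + 2 * (N : ℤ) + 1))
        - β₀ * γ ^ 4 * (γ - δ) / (γ * δ) ^ (2 * (l + (N : ℤ))) = 0)
    (hR5 : ∀ l : ℤ,
      U (2 * l) / V (2 * l + 1) - γ ^ 3 * V (2 * l) / (δ ^ 3 * U (2 * l + 1))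
        + γ ^ 3 * (γ - δ) / ((γ * δ) ^ (2 * l) * α (2 * l)) = 0)
    (hR6 : ∀ l : ℤ,
      U (2 * l + 2) / V (2 * l + 1) - γ * V (2 * l + 2) / (δ * U (2 * l + 1))
        + γ * (γ - δ) / ((γ * δ) ^ (2 * l) * α (2 * l + 1)) = 0)
    (a : ℤ → ℂ) (haz : ∀ i, a i ≠ 0)
    (hap : ∀ i : ℤ, a (i + (2 * (N : ℤ) + 1)) = a i)
    (haα : ∀ i : ℤ, α i = a i ^ (2 * N + 1) * α (i - 1))
    (c q : ℂ) (hc : c ≠ 0) (hq : q ≠ 0)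
    (hcγ : c = γ) (hδc : δ = (γ * δ) / c)
    (hqε : q ^ (2 * N + 1) * (γ * δ) ^ (2 * N - 1) = 1)
    (hprod : ∏ i ∈ Finset.range (2 * N + 1), a (i : ℤ) = q)
    (f g : ℤ → ℂ)
    (hf : ∀ i : ℤ, f i = U (i - 1) / U (i + 1))
    (hg : ∀ i : ℤ, g i = V (i - 1) / V (i + 1)) :
    ∀ l₁ : ℤ, 0 ≤ l₁ → l₁ ≤ (N : ℤ) - 2 →
      g (2 * l₁ + 3) * ((γ * δ) ^ 2 * f (2 * l₁ + 1) - c ^ 4 * g (2 * l₁ + 1))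
          * (a (2 * l₁ + 3) ^ (2 * N + 1) * c ^ 2 - f (2 * l₁ + 3))
        = (γ * δ) ^ 2 * a (2 * l₁ + 2) ^ (2 * N + 1) * a (2 * l₁ + 3) ^ (2 * N + 1)
          * f (2 * l₁ + 2)
          * ((γ * δ) ^ 2 * f (2 * l₁ + 3) - c ^ 4 * g (2 * l₁ + 3))
          * (a (2 * l₁ + 1) ^ (2 * N + 1) * c ^ 2 - f (2 * l₁ + 1)) := by
  intro l _ _
  subst hcγ
  have s1 := haα (2 * l + 1)
  have s2 := haα (2 * l + 2)
  have s3 := haα (2 * l + 3)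
  have p5 := hR5 l
  have p6 := hR6 l
  have q5 := hR5 (l + 1)
  have q6 := hR6 (l + 1)
  have hε : c * δ ≠ 0 := mul_ne_zero hc hδ
  have hz : (c * δ) ^ (2 * (l + 1)) = (c * δ) ^ (2 * l) * (c * δ) ^ 2 := by
    rw [mul_add, zpow_add₀ hε]; norm_cast
  rw [hz] at q5 q6
  have hE : (c * δ) ^ (2 * l) ≠ 0 := zpow_ne_zero _ hε
  generalize (c * δ) ^ (2 * l) = E at *
  rw [show 2 * l + 1 - 1 = 2 * l by ring] at s1
  rw [show 2 * l + 2 - 1 = 2 * l + 1 by ring] at s2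
  rw [show 2 * l + 3 - 1 = 2 * l + 2 by ring] at s3
  rw [show 2 * (l + 1) = 2 * l + 2 by ring, show 2 * l + 2 + 1 = 2 * l + 3 by ring] at q5 q6
  rw [show 2 * l + 2 + 2 = 2 * l + 4 by ring] at q6
  rw [hf, hf, hf, hg, hg, show 2 * l + 1 - 1 = 2 * l by ring,
    show 2 * l + 1 + 1 = 2 * l + 2 by ring, show 2 * l + 2 - 1 = 2 * l + 1 by ring,
    show 2 * l + 2 + 1 = 2 * l + 3 by ring, show 2 * l + 3 - 1 = 2 * l + 2 by ring,
    show 2 * l + 3 + 1 = 2 * l + 4 by ring]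
  have hA1 := pow_ne_zero (2 * N + 1) (haz (2 * l + 1))
  have hA2 := pow_ne_zero (2 * N + 1) (haz (2 * l + 2))
  have hA3 := pow_ne_zero (2 * N + 1) (haz (2 * l + 3))
  rw [s1] at p6
  rw [s3] at q6
  have k1 := aux_key _ _ _ _ _ _ _ _ _ _ _ hc hδ hE hA1 (hα _) (hU _) (hU _) (hV _) (hV _) p5 p6
  have k2 := aux_key _ _ _ _ _ _ _ _ _ _ _ hc hδ (mul_ne_zero hE (pow_ne_zero 2 hε)) hA3 (hα _)
    (hU _) (hU _) (hV _) (hV _) q5 q6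
  rw [k1, k2, s2, s1]
  have := hU (2 * l + 1)
  have := hU (2 * l + 3)
  have := hV (2 * l + 2)
  have := hV (2 * l + 4)
  have := hα (2 * l)
  generalize a (2 * l + 1) ^ (2 * N + 1) * c ^ 2 - U (2 * l) / U (2 * l + 2) = X
  generalize a (2 * l + 3) ^ (2 * N + 1) * c ^ 2 - U (2 * l + 2) / U (2 * l + 4) = Y
  generalize a (2 * l + 1) ^ (2 * N + 1) = A1 at *
  generalize a (2 * l + 2) ^ (2 * N + 1) = A2 at *
  generalize a (2 * l + 3) ^ (2 * N + 1) = A3 at *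
  field_simp
end

section
/- For every integer l₂ with 0 ≤ l₂ ≤ N−1 the following identity holds (equation (2.13c) of Lemma 2.3, written with denominators cleared): (c² − ε²·a_{2l₂+2}^{2N+1}·g_{2l₂+2})·(ε²·a_{2l₂+1}^{2N+1} − c²·g_{2l₂+1}) = ε²·(1 − a_{2l₂+2}^{2N+1}·c²·f_{2l₂+2})·(a_{2l₂+1}^{2N+1}·c² − f_{2l₂+1}). -/
open Finset

/-- Equation (2.13c) of Lemma 2.3, with denominators cleared. -/
theorem stmt_5 (N : ℕ) (hN : 1 ≤ N)
    (γ δ : ℂ) (hγ : γ ≠ 0) (hδ : δ ≠ 0) (hγδ : γ ≠ δ)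
    (α : ℤ → ℂ) (hα : ∀ l, α l ≠ 0) (β₀ : ℂ) (hβ₀ : β₀ ≠ 0)
    (U V : ℤ → ℂ) (hU : ∀ l, U l ≠ 0) (hV : ∀ l, V l ≠ 0)
    (hR3 : ∀ l : ℤ,
      U (2 * l + 1) / V (2 * l + 2 * (N : ℤ) + 2) = V (2 * l + 1) / U (2 * l + 2 * (N : ℤ) + 2))
    (hR4 : ∀ l : ℤ,
      U (2 * l) / V (2 * l + 2 * (N : ℤ) + 1)
        - γ ^ 4 * V (2 * l) / (δ ^ 4 * U (2 * l + 2 * (N : ℤ) + 1))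
        - β₀ * γ ^ 4 * (γ - δ) / (γ * δ) ^ (2 * (l + (N : ℤ))) = 0)
    (hR5 : ∀ l : ℤ,
      U (2 * l) / V (2 * l + 1) - γ ^ 3 * V (2 * l) / (δ ^ 3 * U (2 * l + 1))
        + γ ^ 3 * (γ - δ) / ((γ * δ) ^ (2 * l) * α (2 * l)) = 0)
    (hR6 : ∀ l : ℤ,
      U (2 * l + 2) / V (2 * l + 1) - γ * V (2 * l + 2) / (δ * U (2 * l + 1))
        + γ * (γ - δ) / ((γ * δ) ^ (2 * l) * α (2 * l + 1)) = 0)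
    (a : ℤ → ℂ) (haz : ∀ i, a i ≠ 0)
    (hap : ∀ i : ℤ, a (i + (2 * (N : ℤ) + 1)) = a i)
    (haα : ∀ i : ℤ, α i = a i ^ (2 * N + 1) * α (i - 1))
    (c : ℂ) (hc : c ≠ 0)
    (hcγ : c = γ) (hδc : δ = (γ * δ) / c)
    (f g : ℤ → ℂ)
    (hf : ∀ i : ℤ, f i = U (i - 1) / U (i + 1))
    (hg : ∀ i : ℤ, g i = V (i - 1) / V (i + 1)) :
    ∀ l₂ : ℤ, 0 ≤ l₂ → l₂ ≤ (N : ℤ) - 1 →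
      (c ^ 2 - (γ * δ) ^ 2 * a (2 * l₂ + 2) ^ (2 * N + 1) * g (2 * l₂ + 2))
          * ((γ * δ) ^ 2 * a (2 * l₂ + 1) ^ (2 * N + 1) - c ^ 2 * g (2 * l₂ + 1))
        = (γ * δ) ^ 2
          * (1 - a (2 * l₂ + 2) ^ (2 * N + 1) * c ^ 2 * f (2 * l₂ + 2))
          * (a (2 * l₂ + 1) ^ (2 * N + 1) * c ^ 2 - f (2 * l₂ + 1)) := by
  intro l _ _
  subst hcγ
  have hE : (c * δ) ^ (2 * l) ≠ 0 := zpow_ne_zero _ (mul_ne_zero hγ hδ)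
  have h5 := hR5 l
  have h6 := hR6 l
  have h5' := hR5 (l + 1)
  have e1 := haα (2 * l + 1)
  have e2 := haα (2 * l + 2)
  have hEs : (c * δ) ^ (2 * (l + 1)) = (c * δ) ^ (2 * l) * (c * δ) ^ 2 := by
    rw [show 2 * (l + 1) = 2 * l + ((2 : ℕ) : ℤ) by push_cast; ring,
      zpow_add₀ (mul_ne_zero hγ hδ), zpow_natCast]
  rw [hEs] at h5'
  rw [show 2 * (l + 1) = 2 * l + 2 by ring, show 2 * l + 2 + 1 = 2 * l + 3 by ring] at h5'
  rw [show 2 * l + 1 - 1 = 2 * l by ring] at e1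
  rw [show 2 * l + 2 - 1 = 2 * l + 1 by ring] at e2
  rw [hf, hf, hg, hg, show 2 * l + 1 - 1 = 2 * l by ring,
    show 2 * l + 2 - 1 = 2 * l + 1 by ring, show 2 * l + 2 + 1 = 2 * l + 3 by ring,
    show 2 * l + 1 + 1 = 2 * l + 2 by ring]
  have hA1 : a (2 * l + 1) ^ (2 * N + 1) ≠ 0 := pow_ne_zero _ (haz _)
  have hA2 : a (2 * l + 2) ^ (2 * N + 1) ≠ 0 := pow_ne_zero _ (haz _)
  have a0 := hα (2 * l)
  have a1 := hα (2 * l + 1)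
  have u1 := hU (2 * l + 1)
  have u2 := hU (2 * l + 2)
  have u3 := hU (2 * l + 3)
  have v1 := hV (2 * l + 1)
  have v2 := hV (2 * l + 2)
  have v3 := hV (2 * l + 3)
  rw [e2] at h5'
  generalize a (2 * l + 1) ^ (2 * N + 1) = A1 at *
  generalize a (2 * l + 2) ^ (2 * N + 1) = A2 at *
  generalize (c * δ) ^ (2 * l) = E at *
  generalize α (2 * l) = al0 at *
  generalize α (2 * l + 1) = al1 at *
  generalize U (2 * l) = U0 at *
  generalize U (2 * l + 1) = U1 at *
  generalize U (2 * l + 2) = U2 at *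
  generalize U (2 * l + 3) = U3 at *
  generalize V (2 * l) = V0 at *
  generalize V (2 * l + 1) = V1 at *
  generalize V (2 * l + 2) = V2 at *
  generalize V (2 * l + 3) = V3 at *
  clear hR3 hR4 hR5 hR6 hap haα hδc
  have k1 : U0 / V1 - c ^ 3 * V0 / (δ ^ 3 * U1)
      = c ^ 2 * A1 * (U2 / V1 - c * V2 / (δ * U1)) := by
    have t : c ^ 3 * (c - δ) / (E * al0) = c ^ 2 * A1 * (c * (c - δ) / (E * al1)) := by
      rw [e1]; field_simp
    linear_combination h5 - c ^ 2 * A1 * h6 - t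
  have k2 : U2 / V1 - c * V2 / (δ * U1)
      = δ ^ 2 * A2 * (U2 / V3 - c ^ 3 * V2 / (δ ^ 3 * U3)) := by
    have t : c * (c - δ) / (E * al1)
        = δ ^ 2 * A2 * (c ^ 3 * (c - δ) / (E * (c * δ) ^ 2 * (A2 * al1))) := by
      field_simp
    linear_combination h6 - δ ^ 2 * A2 * h5' - t
  have m1 : δ ^ 3 * (U1 * U2) * (A1 * c ^ 2 - U0 / U2)
      = c ^ 3 * (V1 * V2) * (δ ^ 2 * A1 - V0 / V2) := by
    have t1 : δ ^ 3 * (U1 * U2) * (A1 * c ^ 2 - U0 / U2)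
      - c ^ 3 * (V1 * V2) * (δ ^ 2 * A1 - V0 / V2) = - (δ ^ 3 * U1 * V1) *
        ((U0 / V1 - c ^ 3 * V0 / (δ ^ 3 * U1))
      - c ^ 2 * A1 * (U2 / V1 - c * V2 / (δ * U1))) := by
      field_simp
      ring
    rw [k1, sub_self, mul_zero] at t1
    exact sub_eq_zero.mp t1
  have m2 : δ * (U1 * U2) * (1 - δ ^ 2 * A2 * (V1 / V3))
      = c * (V1 * V2) * (1 - A2 * c ^ 2 * (U1 / U3)) := by
    have t1 : δ * (U1 * U2) * (1 - δ ^ 2 * A2 * (V1 / V3))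
      - c * (V1 * V2) * (1 - A2 * c ^ 2 * (U1 / U3)) = (δ * U1 * V1) *
        ((U2 / V1 - c * V2 / (δ * U1))
      - δ ^ 2 * A2 * (U2 / V3 - c ^ 3 * V2 / (δ ^ 3 * U3))) := by
      field_simp
      ring
    rw [k2, sub_self, mul_zero] at t1
    exact sub_eq_zero.mp t1
  have hne : c * δ * (U1 * U2) * (V1 * V2) ≠ 0 := by positivity
  apply mul_left_cancel₀ hne
  generalize V1 / V3 = g2 at *
  generalize V0 / V2 = g1 at *
  generalize U1 / U3 = f2 at *
  generalize U0 / U2 = f1 at *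
  linear_combination c ^ 2 * (c ^ 3 * (V1 * V2) * (δ ^ 2 * A1 - g1)) * m2
    - c ^ 2 * (c * (V1 * V2) * (1 - A2 * c ^ 2 * f2)) * m1
end

section
/- Assume that the parameters satisfy α_{l+2N+1} = ε^{1−2N}·α_l and β_{m+1} = ε^{2N−1}·β_m for all l, m ∈ ℤ. Let U, V : ℤ → ℂ be nowhere vanishing and define U_{l,m} = U(l−(2N+1)m) and V_{l,m} = V(l−(2N+1)m) for (l,m) ∈ ℤ². Then (U_{l,m}, V_{l,m}) is a solution of the system (S) if and only if U and V satisfy, for all l ∈ ℤ, the reduced system: (R1) U(l)/U(l+2N+2) + γ_l⁴·U(l+1)/U(l+2N+1) + α_l·β₀·γ_l³/ε^{2N−1} = 0; (R2) V(l)/V(l+2N+2) + δ_l⁴·V(l+1)/V(l+2N+1) + α_l·β₀·δ_l³/ε^{2N−1} = 0; (R3) U(2l+1)/V(2l+2N+2) = V(2l+1)/U(2l+2N+2); (R4) U(2l)/V(2l+2N+1) − γ⁴V(2l)/(δ⁴U(2l+2N+1)) − β₀γ⁴(γ−δ)/ε^{2(l+N)} = 0; (R5) U(2l)/V(2l+1)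 − γ³V(2l)/(δ³U(2l+1)) + γ³(γ−δ)/(ε^{2l}α_{2l}) = 0; (R6) U(2l+2)/V(2l+1) − γV(2l+2)/(δU(2l+1)) + γ(γ−δ)/(ε^{2l}α_{2l+1}) = 0. -/
/-- `parfun γ k` is `γ` for even `k` and `γ⁻¹` for odd `k`. -/
noncomputable def parfun (γ : ℂ) (k : ℤ) : ℂ := if Even k then γ else γ⁻¹

/-- A pair of nowhere-vanishing functions `U V : ℤ² → ℂ` is a solution of the
system (S) of the paper (equations (2.1)) with data `(α, β, γ, δ)`. -/
def IsSolutionS (α β : ℤ → ℂ) (γ δ : ℂ) (U V : ℤ → ℤ → ℂ) : Prop :=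
  (∀ l m : ℤ, U l m ≠ 0) ∧ (∀ l m : ℤ, V l m ≠ 0) ∧
  -- (A)
  (∀ l m : ℤ,
    U (l + 1) (m + 1) / U l m + (parfun γ (l + m)) ^ 4 * U l (m + 1) / U (l + 1) m
      + α l * β m * parfun γ (l + m) = 0) ∧
  -- (A')
  (∀ l m : ℤ,
    V (l + 1) (m + 1) / V l m + (parfun δ (l + m)) ^ 4 * V l (m + 1) / V (l + 1) m
      + α l * β m * parfun δ (l + m) = 0) ∧
  -- (B), l+m even
  (∀ l m : ℤ, Even (l + m) →
    U l (m + 1) / V l m = V l (m + 1) / U l m) ∧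
  -- (B), l+m odd
  (∀ l m : ℤ, ¬ Even (l + m) →
    U l (m + 1) / V l m
      = (γ ^ 4 / δ ^ 4) * (V l (m + 1) / U l m
          + β m * δ ^ 4 * (γ - δ) / (γ * δ) ^ (l - 2 * m - 1))) ∧
  -- (C), l+m even
  (∀ l m : ℤ, Even (l + m) →
    U l m / V (l + 1) m
      = (γ ^ 3 / δ ^ 3) * (V l m / U (l + 1) m
          - δ ^ 3 * (γ - δ) / (α l * (γ * δ) ^ (l - 2 * m)))) ∧
  -- (C), l+m odd
  (∀ l m : ℤ, ¬ Even (l + m) →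
    δ * U l m * (U (l + 1) m / V l m + γ * (γ - δ) / (α l * (γ * δ) ^ (l - 2 * m - 1)))
      = γ * V (l + 1) m)

theorem parfun_flip (γ : ℂ) (k M : ℤ) (hM : ¬ Even M) : parfun γ (k + M) = (parfun γ k)⁻¹ := by
  unfold parfun
  by_cases h : Even k
  · have : ¬ Even (k + M) := by rw [Int.even_add]; tauto
    simp [h, this]
  · have : Even (k + M) := by rw [Int.even_add]; tauto
    simp [h, this]

theorem parfun_ne (γ : ℂ) (h : γ ≠ 0) (k : ℤ) : parfun γ k ≠ 0 := by
  unfold parfun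
  split_ifs
  · exact h
  · exact inv_ne_zero h

theorem zpow_iter (f : ℤ → ℂ) (c : ℂ) (hc : c ≠ 0) (h : ∀ m, f (m + 1) = c * f m) (m : ℤ) :
    f m = c ^ m * f 0 := by
  induction m using Int.induction_on with
  | zero => simp
  | succ i ih => rw [h, ih, zpow_add_one₀ hc]; ring
  | pred i ih =>
    have h1 := h (-(i : ℤ) - 1)
    rw [sub_add_cancel, ih] at h1
    rw [zpow_sub_one₀ hc]
    field_simp
    rw [h1, mul_comm]

theorem algA (a b c d g p : ℂ) (hg : g ≠ 0) :
    b / c + g⁻¹ ^ 4 * a / d + p * g⁻¹ = 0 ↔ a / d + g ^ 4 * b / c + p * g ^ 3 = 0 := by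
  have : a / d + g ^ 4 * b / c + p * g ^ 3 = g ^ 4 * (b / c + g⁻¹ ^ 4 * a / d + p * g⁻¹) := by
    rw [div_eq_mul_inv, div_eq_mul_inv, div_eq_mul_inv, div_eq_mul_inv]
    generalize c⁻¹ = c'
    generalize d⁻¹ = d'
    field_simp
    ring
  rw [this]
  simp [hg]

/-- The `(2N+1,1)`-periodic staircase reduction: `(U_{l,m},V_{l,m}) = (U(l-(2N+1)m), V(l-(2N+1)m))`
is a solution of the system (S) iff `U, V` satisfy the reduced system (2.8). -/
theorem stmt_6 (N : ℕ) (hN : 1 ≤ N)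
    (γ δ : ℂ) (hγ : γ ≠ 0) (hδ : δ ≠ 0)
    (α β : ℤ → ℂ) (hα : ∀ k, α k ≠ 0) (hβ : ∀ k, β k ≠ 0)
    (hαp : ∀ l : ℤ, α (l + (2 * (N : ℤ) + 1)) = (γ * δ) ^ (1 - 2 * (N : ℤ)) * α l)
    (hβp : ∀ m : ℤ, β (m + 1) = (γ * δ) ^ (2 * (N : ℤ) - 1) * β m)
    (U V : ℤ → ℂ) (hU : ∀ l, U l ≠ 0) (hV : ∀ l, V l ≠ 0) :
    IsSolutionS α β γ δ
      (fun l m => U (l - (2 * (N : ℤ) + 1) * m)) (fun l m => V (l - (2 * (N : ℤ) + 1) * m)) ↔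
    (∀ l : ℤ,
      -- (R1)
      (U l / U (l + (2 * (N : ℤ) + 2)) + (parfun γ l) ^ 4 * U (l + 1) / U (l + (2 * (N : ℤ) + 1))
        + α l * β 0 * (parfun γ l) ^ 3 / (γ * δ) ^ (2 * (N : ℤ) - 1) = 0) ∧
      -- (R2)
      (V l / V (l + (2 * (N : ℤ) + 2)) + (parfun δ l) ^ 4 * V (l + 1) / V (l + (2 * (N : ℤ) + 1))
        + α l * β 0 * (parfun δ l) ^ 3 / (γ * δ) ^ (2 * (N : ℤ) - 1) = 0) ∧
      -- (R3)
      (U (2 * l + 1) / V (2 * l + 2 * (N : ℤ) + 2) = V (2 * l + 1) / U (2 * l + 2 * (N : ℤ) + 2)) ∧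
      -- (R4)
      (U (2 * l) / V (2 * l + 2 * (N : ℤ) + 1)
        - γ ^ 4 * V (2 * l) / (δ ^ 4 * U (2 * l + 2 * (N : ℤ) + 1))
        - β 0 * γ ^ 4 * (γ - δ) / (γ * δ) ^ (2 * (l + (N : ℤ))) = 0) ∧
      -- (R5)
      (U (2 * l) / V (2 * l + 1) - γ ^ 3 * V (2 * l) / (δ ^ 3 * U (2 * l + 1))
        + γ ^ 3 * (γ - δ) / ((γ * δ) ^ (2 * l) * α (2 * l)) = 0) ∧
      -- (R6)
      (U (2 * l + 2) / V (2 * l + 1) - γ * V (2 * l + 2) / (δ * U (2 * l + 1))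
        + γ * (γ - δ) / ((γ * δ) ^ (2 * l) * α (2 * l + 1)) = 0)) := by
  set ε := γ * δ with hε
  have hε0 : ε ≠ 0 := mul_ne_zero hγ hδ
  set M : ℤ := 2 * (N : ℤ) + 1 with hM
  have hMo : ¬ Even M := by rw [hM]; simp
  have hβm : ∀ m, β m = ε ^ ((2 * (N : ℤ) - 1) * m) * β 0 := fun m => by
    rw [zpow_mul]; exact zpow_iter β _ (zpow_ne_zero _ hε0) hβp m
  have hαm : ∀ n m, α (n + M * m) = ε ^ ((1 - 2 * (N : ℤ)) * m) * α n := fun n m => by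
    rw [zpow_mul]
    have := zpow_iter (fun m => α (n + M * m)) (ε ^ (1 - 2 * (N : ℤ))) (zpow_ne_zero _ hε0)
      (fun m => by
        show α (n + M * (m + 1)) = _ * α (n + M * m)
        rw [← hαp]; congr 1; ring) m
    simpa using this
  have hAB : ∀ k m, α (k + M * (m + 1)) * β m = α k * β 0 / ε ^ (2 * (N : ℤ) - 1) := fun k m => by
    rw [hαm, hβm, div_eq_mul_inv, ← zpow_neg]
    have : ε ^ (-(2 * (N : ℤ) - 1)) = ε ^ ((1 - 2 * (N : ℤ)) * (m + 1)) * ε ^ ((2 * (N : ℤ) - 1) * m) := by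
      rw [← zpow_add₀ hε0]; congr 1; ring
    rw [this]; ring
  have hB : ∀ k m, β m / ε ^ (k + M * (m + 1) - 2 * m - 1) = β 0 / ε ^ (k + 2 * (N : ℤ)) := fun k m => by
    rw [hβm]
    have : ε ^ (k + M * (m + 1) - 2 * m - 1) = ε ^ ((2 * (N : ℤ) - 1) * m) * ε ^ (k + 2 * (N : ℤ)) := by
      rw [← zpow_add₀ hε0]; congr 1; rw [hM]; ring
    rw [this, mul_div_mul_left _ _ (zpow_ne_zero _ hε0)]
  have hC : ∀ n m j, α (n + M * m) * ε ^ (n + M * m - 2 * m - j) = ε ^ (n - j) * α n := fun n m j => by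
    rw [hαm]
    have : ε ^ (n - j) = ε ^ ((1 - 2 * (N : ℤ)) * m) * ε ^ (n + M * m - 2 * m - j) := by
      rw [← zpow_add₀ hε0]; congr 1; rw [hM]; ring
    rw [this]; ring
  have par : ∀ n m : ℤ, Even (n + M * m + m) ↔ Even n := fun n m => by
    rw [show n + M * m + m = n + 2 * (((N : ℤ) + 1) * m) by rw [hM]; ring, Int.even_add]
    simp
  have parf : ∀ (g : ℂ) (k m : ℤ), parfun g (k + M * (m + 1) + m) = (parfun g k)⁻¹ := fun g k m => by
    rw [← parfun_flip g k M hMo]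
    unfold parfun
    rw [show k + M * (m + 1) + m = (k + M) + M * m + m by ring]
    simp only [par]
  have iA : ∀ (W : ℤ → ℂ) (g : ℂ) (hg : g ≠ 0) (k m : ℤ),
      (W (k + M * (m + 1) + 1 - M * (m + 1)) / W (k + M * (m + 1) - M * m)
        + (parfun g (k + M * (m + 1) + m)) ^ 4 * W (k + M * (m + 1) - M * (m + 1))
          / W (k + M * (m + 1) + 1 - M * m)
        + α (k + M * (m + 1)) * β m * parfun g (k + M * (m + 1) + m) = 0) ↔
      (W k / W (k + (2 * (N : ℤ) + 2)) + (parfun g k) ^ 4 * W (k + 1) / W (k + M)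
        + α k * β 0 * (parfun g k) ^ 3 / ε ^ (2 * (N : ℤ) - 1) = 0) := fun W g hg k m => by
    rw [parf, hAB, show k + M * (m + 1) + 1 - M * (m + 1) = k + 1 by ring,
      show k + M * (m + 1) - M * m = k + M by ring,
      show k + M * (m + 1) - M * (m + 1) = k by ring,
      show k + M * (m + 1) + 1 - M * m = k + (2 * (N : ℤ) + 2) by rw [hM]; ring,
      algA _ _ _ _ _ _ (parfun_ne g hg k)]
    rw [mul_div_right_comm (α k * β 0)]
  have iB1 : ∀ j m : ℤ,
      (U (2 * j + 1 + M * (m + 1) - M * (m + 1)) / V (2 * j + 1 + M * (m + 1) - M * m)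
        = V (2 * j + 1 + M * (m + 1) - M * (m + 1)) / U (2 * j + 1 + M * (m + 1) - M * m)) ↔
      (U (2 * j + 1) / V (2 * j + 2 * (N : ℤ) + 2) = V (2 * j + 1) / U (2 * j + 2 * (N : ℤ) + 2)) :=
    fun j m => by
    rw [show 2 * j + 1 + M * (m + 1) - M * (m + 1) = 2 * j + 1 by ring,
      show 2 * j + 1 + M * (m + 1) - M * m = 2 * j + 2 * (N : ℤ) + 2 by rw [hM]; ring]
  have iB2 : ∀ j m : ℤ,
      (U (2 * j + M * (m + 1) - M * (m + 1)) / V (2 * j + M * (m + 1) - M * m)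
        = (γ ^ 4 / δ ^ 4) * (V (2 * j + M * (m + 1) - M * (m + 1)) / U (2 * j + M * (m + 1) - M * m)
          + β m * δ ^ 4 * (γ - δ) / ε ^ (2 * j + M * (m + 1) - 2 * m - 1))) ↔
      (U (2 * j) / V (2 * j + 2 * (N : ℤ) + 1)
        - γ ^ 4 * V (2 * j) / (δ ^ 4 * U (2 * j + 2 * (N : ℤ) + 1))
        - β 0 * γ ^ 4 * (γ - δ) / ε ^ (2 * (j + (N : ℤ))) = 0) := fun j m => by
    have h := hB (2 * j) m
    rw [show 2 * j + 2 * (N : ℤ) = 2 * (j + (N : ℤ)) by ring] at h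
    rw [show 2 * j + M * (m + 1) - M * (m + 1) = 2 * j by ring,
      show 2 * j + M * (m + 1) - M * m = 2 * j + 2 * (N : ℤ) + 1 by rw [hM]; ring,
      show β m * δ ^ 4 * (γ - δ) / ε ^ (2 * j + M * (m + 1) - 2 * m - 1)
        = (β m / ε ^ (2 * j + M * (m + 1) - 2 * m - 1)) * (δ ^ 4 * (γ - δ)) by ring, h,
      ← sub_eq_zero]
    apply Eq.congr_left
    have := hU (2 * j + 2 * (N : ℤ) + 1)
    generalize U (2 * j) / V (2 * j + 2 * (N : ℤ) + 1) = X
    have := zpow_ne_zero (2 * (j + (N : ℤ))) hε0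
    generalize ε ^ (2 * (j + (N : ℤ))) = E at *
    field_simp
    ring
  have iC1 : ∀ j m : ℤ,
      (U (2 * j + M * m - M * m) / V (2 * j + M * m + 1 - M * m)
        = (γ ^ 3 / δ ^ 3) * (V (2 * j + M * m - M * m) / U (2 * j + M * m + 1 - M * m)
          - δ ^ 3 * (γ - δ) / (α (2 * j + M * m) * ε ^ (2 * j + M * m - 2 * m)))) ↔
      (U (2 * j) / V (2 * j + 1) - γ ^ 3 * V (2 * j) / (δ ^ 3 * U (2 * j + 1))
        + γ ^ 3 * (γ - δ) / (ε ^ (2 * j) * α (2 * j)) = 0) := fun j m => by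
    have h := hC (2 * j) m 0
    rw [sub_zero, sub_zero] at h
    rw [show 2 * j + M * m - M * m = 2 * j by ring,
      show 2 * j + M * m + 1 - M * m = 2 * j + 1 by ring, h, ← sub_eq_zero]
    apply Eq.congr_left
    have := hU (2 * j + 1)
    have := hα (2 * j)
    generalize U (2 * j) / V (2 * j + 1) = X
    have := zpow_ne_zero (2 * j) hε0
    generalize ε ^ (2 * j) = E at *
    field_simp
    ring
  have iC2 : ∀ j m : ℤ,
      (δ * U (2 * j + 1 + M * m - M * m) * (U (2 * j + 1 + M * m + 1 - M * m)
          / V (2 * j + 1 + M * m - M * m)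
          + γ * (γ - δ) / (α (2 * j + 1 + M * m) * ε ^ (2 * j + 1 + M * m - 2 * m - 1)))
        = γ * V (2 * j + 1 + M * m + 1 - M * m)) ↔
      (U (2 * j + 2) / V (2 * j + 1) - γ * V (2 * j + 2) / (δ * U (2 * j + 1))
        + γ * (γ - δ) / (ε ^ (2 * j) * α (2 * j + 1)) = 0) := fun j m => by
    have h := hC (2 * j + 1) m 1
    rw [add_sub_cancel_right] at h
    rw [show 2 * j + 1 + M * m - M * m = 2 * j + 1 by ring,
      show 2 * j + 1 + M * m + 1 - M * m = 2 * j + 2 by ring, h, ← sub_eq_zero]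
    have h1 := hU (2 * j + 1)
    generalize U (2 * j + 2) / V (2 * j + 1) = X
    generalize γ * (γ - δ) / (ε ^ (2 * j) * α (2 * j + 1)) = Y
    have : δ * U (2 * j + 1) * (X + Y) - γ * V (2 * j + 2)
        = (δ * U (2 * j + 1)) * (X - γ * V (2 * j + 2) / (δ * U (2 * j + 1)) + Y) := by
      field_simp
      ring
    rw [this]
    simp [hδ, h1]
  have rep : ∀ l m : ℤ, ∃ k, l = k + M * m := fun l m => ⟨l - M * m, by ring⟩
  have parM : ∀ k m : ℤ, Even (k + M * (m + 1) + m) ↔ ¬ Even k := fun k m => by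
    rw [show k + M * (m + 1) + m = (k + M) + M * m + m by ring, par, Int.even_add]
    tauto
  constructor
  · rintro ⟨-, -, hA, hA', hB1, hB2, hC1, hC2⟩ l
    refine ⟨(iA U γ hγ l 0).1 (hA _ _), (iA V δ hδ l 0).1 (hA' _ _),
      (iB1 l 0).1 (hB1 _ _ ?_), (iB2 l 0).1 (hB2 _ _ ?_), (iC1 l 0).1 (hC1 _ _ ?_),
      (iC2 l 0).1 (hC2 _ _ ?_)⟩
    · rw [parM]; simp
    · rw [parM]; simp
    · rw [par]; simp
    · rw [par]; simp
  · intro h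
    refine ⟨fun _ _ => hU _, fun _ _ => hV _, ?_, ?_, ?_, ?_, ?_, ?_⟩
    · intro l m
      obtain ⟨k, rfl⟩ := rep l (m + 1)
      exact (iA U γ hγ k m).2 (h k).1
    · intro l m
      obtain ⟨k, rfl⟩ := rep l (m + 1)
      exact (iA V δ hδ k m).2 (h k).2.1
    · intro l m he
      obtain ⟨k, rfl⟩ := rep l (m + 1)
      rw [parM, Int.not_even_iff_odd] at he
      obtain ⟨j, rfl⟩ := he
      exact (iB1 j m).2 (h j).2.2.1
    · intro l m he
      obtain ⟨k, rfl⟩ := rep l (m + 1)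
      rw [parM, not_not, even_iff_exists_two_mul] at he
      obtain ⟨j, rfl⟩ := he
      exact (iB2 j m).2 (h j).2.2.2.1
    · intro l m he
      obtain ⟨k, rfl⟩ := rep l m
      rw [par, even_iff_exists_two_mul] at he
      obtain ⟨j, rfl⟩ := he
      exact (iC1 j m).2 (h j).2.2.2.2.1
    · intro l m he
      obtain ⟨k, rfl⟩ := rep l m
      rw [par, Int.not_even_iff_odd] at he
      obtain ⟨j, rfl⟩ := he
      exact (iC2 j m).2 (h j).2.2.2.2.2
end

section
/- If (U, V) is a solution of the system (S) with data (α, β, γ, δ), then the pair (U^σ, V^σ) defined by U^σ_{l,m} = U_{l+2,m} and V^σ_{l,m} = V_{l+2,m} is a solution of the system (S) with data (α^σ, β^σ, γ, δ), where α^σ_k = ε²·α_{k+2} and β^σ_k = ε^{−2}·β_k for all k ∈ ℤ. That is, the system (S) is invariant under the transformation σ of the paper. -/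
/-- Invariance of the system (S) under the transformation `σ` of the paper. -/
theorem stmt_7 (γ δ : ℂ) (hγ : γ ≠ 0) (hδ : δ ≠ 0)
    (α β : ℤ → ℂ) (hα : ∀ k, α k ≠ 0) (hβ : ∀ k, β k ≠ 0)
    (U V : ℤ → ℤ → ℂ)
    (h : IsSolutionS α β γ δ U V) :
    IsSolutionS (fun k => (γ * δ) ^ 2 * α (k + 2)) (fun k => (γ * δ) ^ (-2 : ℤ) * β k) γ δ
      (fun l m => U (l + 2) m) (fun l m => V (l + 2) m) := by
  obtain ⟨hU, hV, hA, hA', hB0, hB1, hC0, hC1⟩ := h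
  have he : γ * δ ≠ 0 := mul_ne_zero hγ hδ
  have hev : ∀ l m : ℤ, Even (l + 2 + m) ↔ Even (l + m) := by
    intro l m
    simp only [Int.even_iff]
    omega
  have hpar : ∀ (x : ℂ) (l m : ℤ), parfun x (l + 2 + m) = parfun x (l + m) := by
    intro x l m
    simp only [parfun, hev]
  have hl : ∀ l : ℤ, l + 1 + 2 = l + 2 + 1 := fun l => by ring
  have hab : ∀ a b : ℂ, (γ * δ) ^ 2 * a * ((γ * δ) ^ (-2 : ℤ) * b) = a * b := by
    intro a b
    have : (γ * δ) ^ 2 * (γ * δ) ^ (-2 : ℤ) = 1 := by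
      rw [zpow_neg]
      exact mul_inv_cancel₀ (pow_ne_zero 2 he)
    linear_combination a * b * this
  have hz : ∀ n : ℤ, (γ * δ) ^ (n + 2) = (γ * δ) ^ 2 * (γ * δ) ^ n := by
    intro n
    rw [zpow_add₀ he, mul_comm]
    rfl
  refine ⟨fun l m => hU _ _, fun l m => hV _ _, fun l m => ?_, fun l m => ?_,
    fun l m hp => ?_, fun l m hp => ?_, fun l m hp => ?_, fun l m hp => ?_⟩
  · have := hA (l + 2) m
    simp only [hab, hl]
    rwa [hpar] at this
  · have := hA' (l + 2) m
    simp only [hab, hl]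
    rwa [hpar] at this
  · exact hB0 (l + 2) m ((hev l m).2 hp)
  · have := hB1 (l + 2) m (fun q => hp ((hev l m).1 q))
    rw [show l + 2 - 2 * m - 1 = (l - 2 * m - 1) + 2 by ring, hz] at this
    simp only
    rw [this, zpow_neg]
    congr 2
    rw [div_eq_mul_inv, div_eq_mul_inv, mul_inv]
    norm_cast
    ring
  · have := hC0 (l + 2) m ((hev l m).2 hp)
    rw [show l + 2 - 2 * m = (l - 2 * m) + 2 by ring, hz] at this
    simp only [hl]
    rw [this, mul_left_comm, mul_assoc]
  · have := hC1 (l + 2) m (fun q => hp ((hev l m).1 q))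
    rw [show l + 2 - 2 * m - 1 = (l - 2 * m - 1) + 2 by ring, hz] at this
    simp only [hl]
    rw [← this, mul_left_comm (α (l + 2)), mul_assoc ((γ * δ) ^ 2)]
end

section
/- Fix a positive integer N. If (U, V) is a solution of the system (S) with data (α, β, γ, δ), then the pair (U^w, V^w) defined by U^w_{l,m} = 1/U_{−l+2N+1,−m} and V^w_{l,m} = 1/V_{−l+2N+1,−m} is a solution of the system (S) with data (α^w, β^w, γ⁻¹, δ⁻¹), where α^w_k = ε^{2N−4}·α_{−k+2N} and β^w_k = ε^{−2N+4}·β_{−k−1} for all k ∈ ℤ (note that the new value of ε is ε⁻¹ = (γ⁻¹)(δ⁻¹)). That is, the system (S) is invariant under the transformation w of the paper. -/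
theorem parfun_flip_s8 (γ : ℂ) (a b : ℤ) (h : Even a ↔ ¬ Even b) : parfun γ⁻¹ a = parfun γ b := by
  unfold parfun
  by_cases hb : Even b
  · have : ¬ Even a := fun ha => (h.1 ha) hb
    simp [hb, this]
  · simp [hb, h.2 hb]

/-- Invariance of the system (S) under the transformation `w` of the paper. -/
theorem stmt_8 (N : ℕ) (hN : 0 < N) (γ δ : ℂ) (hγ : γ ≠ 0) (hδ : δ ≠ 0)
    (α β : ℤ → ℂ) (hα : ∀ k, α k ≠ 0) (hβ : ∀ k, β k ≠ 0)
    (U V : ℤ → ℤ → ℂ)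
    (h : IsSolutionS α β γ δ U V) :
    IsSolutionS (fun k => (γ * δ) ^ (2 * (N : ℤ) - 4) * α (-k + 2 * (N : ℤ)))
      (fun k => (γ * δ) ^ (-2 * (N : ℤ) + 4) * β (-k - 1)) γ⁻¹ δ⁻¹
      (fun l m => (U (-l + 2 * (N : ℤ) + 1) (-m))⁻¹)
      (fun l m => (V (-l + 2 * (N : ℤ) + 1) (-m))⁻¹) := by
  obtain ⟨hU, hV, hA, hA', hB0, hB1, hC0, hC1⟩ := h
  have hε : γ * δ ≠ 0 := mul_ne_zero hγ hδ
  have hcoef : ∀ x y : ℂ, (γ * δ) ^ (2 * (N : ℤ) - 4) * x * ((γ * δ) ^ (-2 * (N : ℤ) + 4) * y)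
      = x * y := by
    intro x y
    have : (γ * δ) ^ (2 * (N : ℤ) - 4) * (γ * δ) ^ (-2 * (N : ℤ) + 4) = 1 := by
      rw [← zpow_add₀ hε]
      have : 2 * (N : ℤ) - 4 + (-2 * (N : ℤ) + 4) = 0 := by ring
      rw [this, zpow_zero]
    linear_combination (x * y) * this
  have hinv : ∀ k : ℤ, (γ⁻¹ * δ⁻¹) ^ k = (γ * δ) ^ (-k) := by
    intro k
    rw [← mul_inv, inv_zpow, zpow_neg]
  refine ⟨fun l m => inv_ne_zero (hU _ _), fun l m => inv_ne_zero (hV _ _), ?_, ?_, ?_, ?_, ?_, ?_⟩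
  · intro l m
    have e1 : -(l + 1) + 2 * (N : ℤ) + 1 = -l + 2 * N := by ring
    have e2 : -(m + 1) = -m - 1 := by ring
    have h := hA (-l + 2 * N) (-m - 1)
    have e3 : -m - 1 + 1 = -m := by ring
    simp only [e1, e2, hcoef]
    rw [e3] at h
    rw [parfun_flip_s8 γ (l + m) (-l + 2 * N + (-m - 1)) (by grind), ← h]
    field_simp [hU]
  · intro l m
    have e1 : -(l + 1) + 2 * (N : ℤ) + 1 = -l + 2 * N := by ring
    have e2 : -(m + 1) = -m - 1 := by ring
    have h := hA' (-l + 2 * N) (-m - 1)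
    have e3 : -m - 1 + 1 = -m := by ring
    simp only [e1, e2, hcoef]
    rw [e3] at h
    rw [parfun_flip_s8 δ (l + m) (-l + 2 * N + (-m - 1)) (by grind), ← h]
    field_simp [hV]
  · intro l m hlm
    have e2 : -(m + 1) = -m - 1 := by ring
    have e3 : -m - 1 + 1 = -m := by ring
    have h := hB0 (-l + 2 * N + 1) (-m - 1) (by grind)
    simp only [e2]
    rw [e3] at h
    rw [inv_div_inv, inv_div_inv]
    exact h.symm
  · intro l m hlm
    have e2 : -(m + 1) = -m - 1 := by ring
    have e3 : -m - 1 + 1 = -m := by ring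
    have h := hB1 (-l + 2 * N + 1) (-m - 1) (by grind)
    simp only [e2]
    rw [e3] at h
    rw [inv_div_inv, inv_div_inv, h, hinv]
    have p : (γ * δ) ^ (-2 * (N : ℤ) + 4) = (γ * δ) ^ 5 * (γ * δ) ^ (-(l - 2 * m - 1))
        / (γ * δ) ^ (-l + 2 * (N : ℤ) + 1 - 2 * (-m - 1) - 1) := by
      rw [eq_div_iff (zpow_ne_zero _ hε), ← zpow_natCast, ← zpow_add₀ hε, ← zpow_add₀ hε]
      congr 1
      push_cast
      ring
    rw [p]
    have q1 := zpow_ne_zero (-(l - 2 * m - 1)) hε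
    have q2 := zpow_ne_zero (-l + 2 * (N : ℤ) + 1 - 2 * (-m - 1) - 1) hε
    generalize (γ * δ) ^ (-(l - 2 * m - 1)) = X at *
    generalize (γ * δ) ^ (-l + 2 * (N : ℤ) + 1 - 2 * (-m - 1) - 1) = Y at *
    have u1 := hU (-l + 2 * N + 1) (-m - 1)
    clear h p
    field_simp
    ring
  · intro l m hlm
    have e1 : -(l + 1) + 2 * (N : ℤ) + 1 = -l + 2 * N := by ring
    have h := hC0 (-l + 2 * N) (-m) (by grind)
    simp only [e1]
    rw [inv_div_inv, inv_div_inv, h, hinv]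
    have p : (γ * δ) ^ (-l + 2 * (N : ℤ) - 2 * -m) = (γ * δ) ^ 4 * ((γ * δ) ^ (2 * (N : ℤ) - 4)
        * (γ * δ) ^ (-(l - 2 * m))) := by
      rw [← zpow_natCast, ← zpow_add₀ hε, ← zpow_add₀ hε]
      congr 1
      push_cast
      ring
    rw [p]
    have q1 := zpow_ne_zero (-(l - 2 * m)) hε
    have q2 := zpow_ne_zero (2 * (N : ℤ) - 4) hε
    generalize (γ * δ) ^ (-(l - 2 * m)) = X at *
    generalize (γ * δ) ^ (2 * (N : ℤ) - 4) = Y at *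
    have u1 := hU (-l + 2 * N + 1) (-m)
    have a1 := hα (-l + 2 * N)
    clear h p
    field_simp
    ring
  · intro l m hlm
    have e1 : -(l + 1) + 2 * (N : ℤ) + 1 = -l + 2 * N := by ring
    have h := hC1 (-l + 2 * N) (-m) (by grind)
    simp only [e1]
    rw [hinv]
    have p : (γ * δ) ^ (-l + 2 * (N : ℤ) - 2 * -m - 1) = (γ * δ) ^ 2 * ((γ * δ) ^ (2 * (N : ℤ) - 4)
        * (γ * δ) ^ (-(l - 2 * m - 1))) := by
      rw [← zpow_natCast, ← zpow_add₀ hε, ← zpow_add₀ hε]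
      congr 1
      push_cast
      ring
    rw [p] at h
    have q1 := zpow_ne_zero (-(l - 2 * m - 1)) hε
    have q2 := zpow_ne_zero (2 * (N : ℤ) - 4) hε
    clear p
    generalize (γ * δ) ^ (-(l - 2 * m - 1)) = X at *
    generalize (γ * δ) ^ (2 * (N : ℤ) - 4) = Y at *
    have u1 := hU (-l + 2 * N + 1) (-m)
    have u2 := hU (-l + 2 * N) (-m)
    have v1 := hV (-l + 2 * N) (-m)
    have a1 := hα (-l + 2 * N)
    have h2 : V (-l + 2 * N + 1) (-m) = _ := (mul_left_cancel₀ hγ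
      (h.symm.trans (mul_div_cancel₀ _ hγ).symm))
    rw [h2]
    clear h h2
    field_simp
    ring
end

section
/- If (U, V) is a solution of the system (S) with data (α, β, γ, δ), then the swapped pair (V, U) is a solution of the system (S) with data (α, β, δ, γ), i.e. with γ and δ interchanged (so the roles of γ_k and δ_k are interchanged while ε = γδ is unchanged). That is, the system (S) is invariant under the transformation μ of the paper, which interchanges U ↔ V and γ ↔ δ. -/
/-- Invariance of the system (S) under the transformation `μ` of the paper,
which interchanges `U ↔ V` and `γ ↔ δ`. -/
theorem stmt_9 (γ δ : ℂ) (hγ : γ ≠ 0) (hδ : δ ≠ 0)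
    (α β : ℤ → ℂ) (hα : ∀ k, α k ≠ 0) (hβ : ∀ k, β k ≠ 0)
    (U V : ℤ → ℤ → ℂ)
    (h : IsSolutionS α β γ δ U V) :
    IsSolutionS α β δ γ V U := by
  obtain ⟨hU, hV, hA, hA', hB0, hB1, hC0, hC1⟩ := h
  refine ⟨hV, hU, hA', hA, fun l m h => (hB0 l m h).symm, ?_, ?_, ?_⟩
  · intro l m h
    rw [hB1 l m h, mul_comm δ γ]
    have hE : (γ * δ) ^ (l - 2 * m - 1) ≠ 0 := zpow_ne_zero _ (mul_ne_zero hγ hδ)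
    generalize (γ * δ) ^ (l - 2 * m - 1) = E at *
    have := hU l m
    field_simp
    ring
  · intro l m h
    rw [hC0 l m h, mul_comm δ γ]
    have hE : (γ * δ) ^ (l - 2 * m) ≠ 0 := zpow_ne_zero _ (mul_ne_zero hγ hδ)
    generalize (γ * δ) ^ (l - 2 * m) = E at *
    have := hU (l + 1) m
    have := hα l
    field_simp
    ring
  · intro l m h
    have h1 := hC1 l m h
    rw [mul_comm δ γ]
    have hE : (γ * δ) ^ (l - 2 * m - 1) ≠ 0 := zpow_ne_zero _ (mul_ne_zero hγ hδ)
    generalize (γ * δ) ^ (l - 2 * m - 1) = E at *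
    have hu := hU l m
    have hv := hV l m
    have ha := hα l
    have h2 : γ * V l m * (V (l + 1) m / U l m + δ * (δ - γ) / (α l * E))
        = V l m / U l m * (γ * V (l + 1) m) + γ * V l m * (δ * (δ - γ) / (α l * E)) := by
      field_simp
    rw [h2, ← h1]
    field_simp
    ring
end

section
/- The transformations σ, w, μ satisfy the relations (2.5) of the paper as maps of the data space D: (i) w∘w = id and μ∘μ = id; (ii) σ∘w = w∘σ⁻¹, where σ⁻¹(α, β, γ, δ, U, V) = (α', β', γ, δ, U', V') with α'_k = ε^{−2}·α_{k−2}, β'_k = ε²·β_k, U'_{l,m} = U_{l−2,m}, V'_{l,m} = V_{l−2,m}; (iii) σ∘μ = μ∘σ; (iv) w∘μ = μ∘w; and (v) for every positive integer k, the k-fold composite σ^k is not the identity map of D. -/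
/-- The data space `D`: tuples `(α, β, γ, δ, U, V)` of nonzero parameter families,
nonzero parameters and nowhere-vanishing functions. -/
structure DataD where
  α : ℤ → ℂ
  β : ℤ → ℂ
  γ : ℂ
  δ : ℂ
  U : ℤ → ℤ → ℂ
  V : ℤ → ℤ → ℂ
  hα : ∀ k, α k ≠ 0
  hβ : ∀ k, β k ≠ 0
  hγ : γ ≠ 0
  hδ : δ ≠ 0
  hU : ∀ l m, U l m ≠ 0
  hV : ∀ l m, V l m ≠ 0

/-- The transformation `σ` of the data space `D`. -/
noncomputable def sigmaMap (d : DataD) : DataD where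
  α := fun k => (d.γ * d.δ) ^ 2 * d.α (k + 2)
  β := fun k => (d.γ * d.δ) ^ (-2 : ℤ) * d.β k
  γ := d.γ
  δ := d.δ
  U := fun l m => d.U (l + 2) m
  V := fun l m => d.V (l + 2) m
  hα := fun _ => mul_ne_zero (pow_ne_zero 2 (mul_ne_zero d.hγ d.hδ)) (d.hα _)
  hβ := fun _ => mul_ne_zero (zpow_ne_zero _ (mul_ne_zero d.hγ d.hδ)) (d.hβ _)
  hγ := d.hγ
  hδ := d.hδ
  hU := fun _ _ => d.hU _ _
  hV := fun _ _ => d.hV _ _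

/-- The inverse `σ⁻¹` of the transformation `σ` of the data space `D`. -/
noncomputable def sigmaInvMap (d : DataD) : DataD where
  α := fun k => (d.γ * d.δ) ^ (-2 : ℤ) * d.α (k - 2)
  β := fun k => (d.γ * d.δ) ^ 2 * d.β k
  γ := d.γ
  δ := d.δ
  U := fun l m => d.U (l - 2) m
  V := fun l m => d.V (l - 2) m
  hα := fun _ => mul_ne_zero (zpow_ne_zero _ (mul_ne_zero d.hγ d.hδ)) (d.hα _)
  hβ := fun _ => mul_ne_zero (pow_ne_zero 2 (mul_ne_zero d.hγ d.hδ)) (d.hβ _)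
  hγ := d.hγ
  hδ := d.hδ
  hU := fun _ _ => d.hU _ _
  hV := fun _ _ => d.hV _ _

/-- The transformation `w` of the data space `D`. -/
noncomputable def wMap (N : ℕ) (d : DataD) : DataD where
  α := fun k => (d.γ * d.δ) ^ (2 * (N : ℤ) - 4) * d.α (-k + 2 * (N : ℤ))
  β := fun k => (d.γ * d.δ) ^ (-2 * (N : ℤ) + 4) * d.β (-k - 1)
  γ := d.γ⁻¹
  δ := d.δ⁻¹
  U := fun l m => (d.U (-l + 2 * (N : ℤ) + 1) (-m))⁻¹
  V := fun l m => (d.V (-l + 2 * (N : ℤ) + 1) (-m))⁻¹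
  hα := fun _ => mul_ne_zero (zpow_ne_zero _ (mul_ne_zero d.hγ d.hδ)) (d.hα _)
  hβ := fun _ => mul_ne_zero (zpow_ne_zero _ (mul_ne_zero d.hγ d.hδ)) (d.hβ _)
  hγ := inv_ne_zero d.hγ
  hδ := inv_ne_zero d.hδ
  hU := fun _ _ => inv_ne_zero (d.hU _ _)
  hV := fun _ _ => inv_ne_zero (d.hV _ _)

/-- The transformation `μ` of the data space `D`. -/
def muMap (d : DataD) : DataD where
  α := d.α
  β := d.β
  γ := d.δ
  δ := d.γ
  U := d.V
  V := d.U
  hα := d.hα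
  hβ := d.hβ
  hγ := d.hδ
  hδ := d.hγ
  hU := d.hV
  hV := d.hU

theorem DataD.eq_of {a b : DataD} (h1 : ∀ k, a.α k = b.α k) (h2 : ∀ k, a.β k = b.β k)
    (h3 : a.γ = b.γ) (h4 : a.δ = b.δ) (h5 : ∀ l m, a.U l m = b.U l m)
    (h6 : ∀ l m, a.V l m = b.V l m) : a = b := by
  have e1 := funext h1
  have e2 := funext h2
  have e5 := funext fun l => funext (h5 l)
  have e6 := funext fun l => funext (h6 l)
  cases a
  cases b
  simp only at e1 e2 h3 h4 e5 e6
  subst e1 e2 h3 h4 e5 e6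
  rfl

theorem sigma_iter_U (k : ℕ) (d : DataD) (l m : ℤ) :
    (sigmaMap^[k] d).U l m = d.U (l + 2 * k) m := by
  induction k generalizing l with
  | zero => simp
  | succ n ih =>
    rw [Function.iterate_succ_apply']
    change (sigmaMap^[n] d).U (l + 2) m = _
    rw [ih]
    congr 1
    push_cast
    ring

/-- A test point on which all iterates of `σ` act nontrivially. -/
noncomputable def testD : DataD where
  α := fun _ => 1
  β := fun _ => 1
  γ := 1
  δ := 1
  U := fun l _ => if l = 0 then 2 else 1
  V := fun _ _ => 1
  hα := fun _ => one_ne_zero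
  hβ := fun _ => one_ne_zero
  hγ := one_ne_zero
  hδ := one_ne_zero
  hU := fun l _ => by split_ifs <;> norm_num
  hV := fun _ _ => one_ne_zero

/-- Relations (2.5) of the paper for the transformations `σ`, `w`, `μ` of the data
space `D`: `w² = μ² = 1`, `σw = wσ⁻¹`, `σμ = μσ`, `wμ = μw`, and `σ` has infinite order. -/
theorem stmt_10 (N : ℕ) (hN : 0 < N) :
    (wMap N ∘ wMap N = id) ∧
    (muMap ∘ muMap = id) ∧
    (sigmaMap ∘ wMap N = wMap N ∘ sigmaInvMap) ∧
    (sigmaMap ∘ muMap = muMap ∘ sigmaMap) ∧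
    (wMap N ∘ muMap = muMap ∘ wMap N) ∧
    (∀ k : ℕ, 0 < k → sigmaMap^[k] ≠ id) := by
  refine ⟨?_, ?_, ?_, ?_, ?_, ?_⟩
  · funext d
    have he : d.γ * d.δ ≠ 0 := mul_ne_zero d.hγ d.hδ
    apply DataD.eq_of
    · intro k
      simp only [Function.comp, wMap, id]
      rw [← mul_inv, inv_zpow, inv_mul_cancel_left₀ (zpow_ne_zero _ he)]
      congr 1
      ring
    · intro k
      simp only [Function.comp, wMap, id]
      rw [← mul_inv, inv_zpow, inv_mul_cancel_left₀ (zpow_ne_zero _ he)]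
      congr 1
      ring
    · simp [wMap]
    · simp [wMap]
    · intro l m
      simp only [Function.comp, wMap, id, inv_inv, neg_neg]
      congr 1
      ring
    · intro l m
      simp only [Function.comp, wMap, id, inv_inv, neg_neg]
      congr 1
      ring
  · rfl
  · funext d
    have he : d.γ * d.δ ≠ 0 := mul_ne_zero d.hγ d.hδ
    apply DataD.eq_of
    · intro k
      simp only [Function.comp, wMap, sigmaMap, sigmaInvMap]
      rw [← mul_inv, show -(k + 2) + 2 * (N : ℤ) = -k + 2 * (N : ℤ) - 2 by ring, inv_pow,
        zpow_neg, mul_left_comm]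
      rfl
    · intro k
      simp only [Function.comp, wMap, sigmaMap, sigmaInvMap]
      rw [← mul_inv, inv_zpow, zpow_neg, inv_inv, mul_left_comm]
      rfl
    · rfl
    · rfl
    · intro l m
      simp only [Function.comp, wMap, sigmaMap, sigmaInvMap]
      congr 2
      ring
    · intro l m
      simp only [Function.comp, wMap, sigmaMap, sigmaInvMap]
      congr 2
      ring
  · funext d
    apply DataD.eq_of <;> intros <;> simp [muMap, sigmaMap, mul_comm d.γ d.δ]
  · funext d
    apply DataD.eq_of <;> intros <;> simp [muMap, wMap, mul_comm d.γ d.δ]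
  · intro k hk h
    have h1 := sigma_iter_U k testD 0 0
    rw [h] at h1
    have hk' : k ≠ 0 := hk.ne'
    simp [testD, hk'] at h1
end

section
/- Suppose (R5) and (R6) hold at a given index l ∈ ℤ. Then A(l+1) − A(l) = −( U(2l+1)/(α_{2l}·γ^{4l}·U(2l)) )·( 1 − α_{2l}·U(2l)/(α_{2l+1}·γ²·U(2l+2)) ). (This is equation (2.15) in the proof of Lemma 2.3, obtained by eliminating V(2l+1) from (R5) and (R6).) -/
/-- Equation (2.15) in the proof of Lemma 2.3: eliminating `V(2l+1)` from (R5) and (R6). -/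
theorem stmt_11 (N : ℕ) (hN : 1 ≤ N)
    (γ δ : ℂ) (hγ : γ ≠ 0) (hδ : δ ≠ 0) (hγδ : γ ≠ δ)
    (α : ℤ → ℂ) (hα : ∀ l, α l ≠ 0) (β₀ : ℂ) (hβ₀ : β₀ ≠ 0)
    (U V : ℤ → ℂ) (hU : ∀ l, U l ≠ 0) (hV : ∀ l, V l ≠ 0)
    (A : ℤ → ℂ)
    (hA : ∀ l : ℤ,
      A l = (γ * δ) ^ (2 * l - 3) * V (2 * l) / (γ ^ (4 * l - 3) * (γ - δ) * U (2 * l)))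
    (l : ℤ)
    (hR5 : U (2 * l) / V (2 * l + 1) - γ ^ 3 * V (2 * l) / (δ ^ 3 * U (2 * l + 1))
      + γ ^ 3 * (γ - δ) / ((γ * δ) ^ (2 * l) * α (2 * l)) = 0)
    (hR6 : U (2 * l + 2) / V (2 * l + 1) - γ * V (2 * l + 2) / (δ * U (2 * l + 1))
      + γ * (γ - δ) / ((γ * δ) ^ (2 * l) * α (2 * l + 1)) = 0) :
    A (l + 1) - A l
      = -(U (2 * l + 1) / (α (2 * l) * γ ^ (4 * l) * U (2 * l)))
        * (1 - α (2 * l) * U (2 * l) / (α (2 * l + 1) * γ ^ 2 * U (2 * l + 2))) := by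
  have hε : γ * δ ≠ 0 := mul_ne_zero hγ hδ
  have hd : γ - δ ≠ 0 := sub_ne_zero.mpr hγδ
  have e1 : (γ * δ) ^ (2 * l - 3) = (γ * δ) ^ (2 * l) / (γ * δ) ^ 3 := by
    rw [zpow_sub₀ hε]; norm_cast
  have e2 : γ ^ (4 * l - 3) = γ ^ (4 * l) / γ ^ 3 := by
    rw [zpow_sub₀ hγ]; norm_cast
  have e3 : (γ * δ) ^ (2 * (l + 1) - 3) = (γ * δ) ^ (2 * l) / (γ * δ) := by
    rw [show 2 * (l + 1) - 3 = 2 * l - 1 by ring, zpow_sub₀ hε, zpow_one]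
  have e4 : γ ^ (4 * (l + 1) - 3) = γ ^ (4 * l) * γ := by
    rw [show 4 * (l + 1) - 3 = 4 * l + 1 by ring, zpow_add₀ hγ, zpow_one]
  rw [hA (l + 1), hA l, e1, e2, e3, e4, show 2 * (l + 1) = 2 * l + 2 by ring]
  have he : (γ * δ) ^ (2 * l) ≠ 0 := zpow_ne_zero _ hε
  have hg : γ ^ (4 * l) ≠ 0 := zpow_ne_zero _ hγ
  generalize (γ * δ) ^ (2 * l) = e at *
  generalize γ ^ (4 * l) = g at *
  have u0 := hU (2 * l)
  have u1 := hU (2 * l + 1)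
  have u2 := hU (2 * l + 2)
  have v1 := hV (2 * l + 1)
  have a0 := hα (2 * l)
  have a1 := hα (2 * l + 1)
  generalize U (2 * l) = U0 at *
  generalize U (2 * l + 1) = U1 at *
  generalize U (2 * l + 2) = U2 at *
  generalize V (2 * l) = V0 at *
  generalize V (2 * l + 1) = V1 at *
  generalize V (2 * l + 2) = V2 at *
  generalize α (2 * l) = b0 at *
  generalize α (2 * l + 1) = b1 at *
  linear_combination (exp := 1) (-(e * U1 / (g * γ ^ 3 * (γ - δ))) / U2) * hR6
    + (e * U1 / (g * γ ^ 3 * (γ - δ)) / U0) * hR5 + (by field_simp; ring :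
      e / (γ * δ) * V2 / (g * γ * (γ - δ) * U2) - e / (γ * δ) ^ 3 * V0 / (g / γ ^ 3 * (γ - δ) * U0)
      - (-(U1 / (b0 * g * U0)) * (1 - b0 * U0 / (b1 * γ ^ 2 * U2)))
      = (-(e * U1 / (g * γ ^ 3 * (γ - δ))) / U2) * (U2 / V1 - γ * V2 / (δ * U1) + γ * (γ - δ) / (e * b1))
      + (e * U1 / (g * γ ^ 3 * (γ - δ)) / U0) * (U0 / V1 - γ ^ 3 * V0 / (δ ^ 3 * U1) + γ ^ 3 * (γ - δ) / (e * b0)))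
end

section
/- Suppose (R5) and (R6) hold for all l ∈ ℤ and (R4) holds at l = 0. Then for every integer l with 0 ≤ l ≤ N−1 such that A(l+1) ≠ A(l), the following identity holds: (1 − α_{2l}U(2l)/(α_{2l+1}γ²U(2l+2)))·(A(l+1) − (ε^{2N−1}/γ^{4N−2})·A(l))/(A(l+1) − A(l)) = −Σ_{k=l+1}^{N−1} ( α_{2l}·U(2k+1)·U(2l)/(α_{2k}·γ^{4(k−l)}·U(2l+1)·U(2k)) )·( 1 − α_{2k}·U(2k)/(α_{2k+1}·γ²·U(2k+2)) ) − (ε^{2N−1}/γ^{4N−2})·Σ_{k=0}^{l−1} ( α_{2l}·γ^{4(l−k)}·U(2k+1)·U(2l)/(α_{2k}·U(2l+1)·U(2k)) )·( 1 − α_{2k}·U(2k)/(α_{2k+1}·γ²·U(2k+2)) ) − ( α_{2l}·U(2N+1)·U(2l)/(α_{2N}·γ^{4(N−l)}·U(2l+1)·U(0)) )·( α_{2N}·β₀·γ + U(0)/U(2N) ), where empty sums equal 0. (This is equation (2.19) in the proof of Lemma 2.3.) -/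
open Finset

/-- Equation (2.19) in the proof of Lemma 2.3. -/
theorem stmt_13 (N : ℕ) (hN : 1 ≤ N)
    (γ δ : ℂ) (hγ : γ ≠ 0) (hδ : δ ≠ 0) (hγδ : γ ≠ δ)
    (α : ℤ → ℂ) (hα : ∀ l, α l ≠ 0) (β₀ : ℂ) (hβ₀ : β₀ ≠ 0)
    (U V : ℤ → ℂ) (hU : ∀ l, U l ≠ 0) (hV : ∀ l, V l ≠ 0)
    (A : ℤ → ℂ)
    (hA : ∀ l : ℤ,
      A l = (γ * δ) ^ (2 * l - 3) * V (2 * l) / (γ ^ (4 * l - 3) * (γ - δ) * U (2 * l)))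
    (hR5 : ∀ l : ℤ,
      U (2 * l) / V (2 * l + 1) - γ ^ 3 * V (2 * l) / (δ ^ 3 * U (2 * l + 1))
        + γ ^ 3 * (γ - δ) / ((γ * δ) ^ (2 * l) * α (2 * l)) = 0)
    (hR6 : ∀ l : ℤ,
      U (2 * l + 2) / V (2 * l + 1) - γ * V (2 * l + 2) / (δ * U (2 * l + 1))
        + γ * (γ - δ) / ((γ * δ) ^ (2 * l) * α (2 * l + 1)) = 0)
    (hR4 : U 0 / V (2 * (N : ℤ) + 1) - γ ^ 4 * V 0 / (δ ^ 4 * U (2 * (N : ℤ) + 1))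
      - β₀ * γ ^ 4 * (γ - δ) / (γ * δ) ^ (2 * (N : ℤ)) = 0) :
    ∀ l : ℕ, l ≤ N - 1 → A ((l : ℤ) + 1) ≠ A (l : ℤ) →
      (1 - α (2 * (l : ℤ)) * U (2 * (l : ℤ))
            / (α (2 * (l : ℤ) + 1) * γ ^ 2 * U (2 * (l : ℤ) + 2)))
          * ((A ((l : ℤ) + 1) - (γ * δ) ^ (2 * N - 1) / γ ^ (4 * N - 2) * A (l : ℤ))
              / (A ((l : ℤ) + 1) - A (l : ℤ)))
        = -(∑ k ∈ Finset.Ico (l + 1) N,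
              (α (2 * (l : ℤ)) * U (2 * (k : ℤ) + 1) * U (2 * (l : ℤ))
                  / (α (2 * (k : ℤ)) * γ ^ (4 * (k - l)) * U (2 * (l : ℤ) + 1) * U (2 * (k : ℤ))))
                * (1 - α (2 * (k : ℤ)) * U (2 * (k : ℤ))
                    / (α (2 * (k : ℤ) + 1) * γ ^ 2 * U (2 * (k : ℤ) + 2))))
          - (γ * δ) ^ (2 * N - 1) / γ ^ (4 * N - 2)
            * ∑ k ∈ Finset.range l,
                (α (2 * (l : ℤ)) * γ ^ (4 * (l - k)) * U (2 * (k : ℤ) + 1) * U (2 * (l : ℤ))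
                    / (α (2 * (k : ℤ)) * U (2 * (l : ℤ) + 1) * U (2 * (k : ℤ))))
                  * (1 - α (2 * (k : ℤ)) * U (2 * (k : ℤ))
                      / (α (2 * (k : ℤ) + 1) * γ ^ 2 * U (2 * (k : ℤ) + 2)))
          - (α (2 * (l : ℤ)) * U (2 * (N : ℤ) + 1) * U (2 * (l : ℤ))
                / (α (2 * (N : ℤ)) * γ ^ (4 * (N - l)) * U (2 * (l : ℤ) + 1) * U 0))
              * (α (2 * (N : ℤ)) * β₀ * γ + U 0 / U (2 * (N : ℤ))) := by
  have hgd : γ - δ ≠ 0 := sub_ne_zero.mpr hγδ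
  have hε : γ * δ ≠ 0 := mul_ne_zero hγ hδ
  have key : ∀ k : ℕ, U (2 * (k : ℤ) + 1) / (α (2 * (k : ℤ)) * γ ^ (4 * k) * U (2 * (k : ℤ)))
      * (1 - α (2 * (k : ℤ)) * U (2 * (k : ℤ))
            / (α (2 * (k : ℤ) + 1) * γ ^ 2 * U (2 * (k : ℤ) + 2)))
      = A (k : ℤ) - A (((k + 1 : ℕ) : ℤ)) := by
    intro k
    have h5 := hR5 k
    have h6 := hR6 k
    have a0 := hA k
    have a1 := hA ((k : ℤ) + 1)
    have e1 : (γ * δ) ^ (2 * (k : ℤ) - 3) = (γ * δ) ^ (2 * (k : ℤ)) / (γ * δ) ^ 3 := by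
      rw [zpow_sub₀ hε]; norm_cast
    have e2 : γ ^ (4 * (k : ℤ) - 3) = γ ^ (4 * k) / γ ^ 3 := by
      rw [zpow_sub₀ hγ]; norm_cast
    have e3 : (γ * δ) ^ (2 * ((k : ℤ) + 1) - 3) = (γ * δ) ^ (2 * (k : ℤ)) / (γ * δ) := by
      rw [show 2 * ((k : ℤ) + 1) - 3 = 2 * (k : ℤ) - 1 by ring, zpow_sub₀ hε, zpow_one]
    have e4 : γ ^ (4 * ((k : ℤ) + 1) - 3) = γ ^ (4 * k) * γ := by
      rw [show 4 * ((k : ℤ) + 1) - 3 = 4 * (k : ℤ) + 1 by ring, zpow_add₀ hγ, zpow_one]; norm_cast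
    rw [e1, e2] at a0
    rw [e3, e4] at a1
    rw [show 2 * ((k : ℤ) + 1) = 2 * (k : ℤ) + 2 by ring] at a1
    push_cast
    rw [a0, a1]
    have hP : (γ * δ) ^ (2 * (k : ℤ)) ≠ 0 := zpow_ne_zero _ hε
    have hG : γ ^ (4 * k) ≠ 0 := pow_ne_zero _ hγ
    have n1 := hU (2 * (k : ℤ))
    have n2 := hU (2 * (k : ℤ) + 1)
    have n3 := hU (2 * (k : ℤ) + 2)
    have n4 := hV (2 * (k : ℤ) + 1)
    have n5 := hα (2 * (k : ℤ))
    have n6 := hα (2 * (k : ℤ) + 1)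
    generalize (γ * δ) ^ (2 * (k : ℤ)) = P at *
    generalize γ ^ (4 * k) = G at *
    generalize U (2 * (k : ℤ)) = u at *
    generalize U (2 * (k : ℤ) + 1) = w at *
    generalize U (2 * (k : ℤ) + 2) = u' at *
    generalize V (2 * (k : ℤ) + 1) = x at *
    generalize V (2 * (k : ℤ)) = v at *
    generalize V (2 * (k : ℤ) + 2) = v' at *
    generalize α (2 * (k : ℤ)) = a at *
    generalize α (2 * (k : ℤ) + 1) = a' at *
    linear_combination (norm := (field_simp; ring)) (w * P / (γ ^ 3 * (γ - δ) * G * u)) * h5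
      - (w * P / (γ ^ 3 * (γ - δ) * G * u')) * h6
  have last : U (2 * (N : ℤ) + 1) / (α (2 * (N : ℤ)) * γ ^ (4 * N) * U 0)
      * (α (2 * (N : ℤ)) * β₀ * γ + U 0 / U (2 * (N : ℤ)))
      = A (N : ℤ) - (γ * δ) ^ (2 * N - 1) / γ ^ (4 * N - 2) * A ((0 : ℕ) : ℤ) := by
    have h5 := hR5 N
    have h4 := hR4
    have a0 := hA N
    have a1 := hA 0
    have e1 : (γ * δ) ^ (2 * (N : ℤ) - 3) = (γ * δ) ^ (2 * (N : ℤ)) / (γ * δ) ^ 3 := by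
      rw [zpow_sub₀ hε]; norm_cast
    have e2 : γ ^ (4 * (N : ℤ) - 3) = γ ^ (4 * N) / γ ^ 3 := by
      rw [zpow_sub₀ hγ]; norm_cast
    have e3 : (γ * δ) ^ (2 * N - 1) = (γ * δ) ^ (2 * (N : ℤ)) / (γ * δ) := by
      rw [pow_sub₀ _ hε (by omega), pow_one, div_eq_mul_inv]; norm_cast
    have e4 : γ ^ (4 * N - 2) = γ ^ (4 * N) / γ ^ 2 := by
      rw [pow_sub₀ _ hγ (by omega), div_eq_mul_inv]
    have e5 : (γ * δ) ^ (2 * (0 : ℤ) - 3) = 1 / (γ * δ) ^ 3 := by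
      rw [zpow_sub₀ hε]; norm_cast
    have e6 : γ ^ (4 * (0 : ℤ) - 3) = 1 / γ ^ 3 := by
      rw [zpow_sub₀ hγ]; norm_cast
    rw [e1, e2] at a0
    rw [e5, e6, mul_zero] at a1
    rw [e3, e4, Nat.cast_zero, a0, a1]
    have hP : (γ * δ) ^ (2 * (N : ℤ)) ≠ 0 := zpow_ne_zero _ hε
    have hG : γ ^ (4 * N) ≠ 0 := pow_ne_zero _ hγ
    have n1 := hU (2 * (N : ℤ))
    have n2 := hU (2 * (N : ℤ) + 1)
    have n3 := hU 0
    have n4 := hV (2 * (N : ℤ) + 1)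
    have n5 := hα (2 * (N : ℤ))
    clear e1 e2 e3 e4 e5 e6 a0 a1 key
    generalize (γ * δ) ^ (2 * (N : ℤ)) = P at *
    generalize γ ^ (4 * N) = G at *
    generalize U (2 * (N : ℤ)) = u at *
    generalize U (2 * (N : ℤ) + 1) = w at *
    generalize U 0 = u' at *
    generalize V (2 * (N : ℤ) + 1) = x at *
    generalize V (2 * (N : ℤ)) = v at *
    generalize V 0 = v' at *
    generalize α (2 * (N : ℤ)) = a at *
    linear_combination (norm := (field_simp; ring)) (w * P / (γ ^ 3 * (γ - δ) * G * u)) * h5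
      - (w * P / (γ ^ 3 * (γ - δ) * G * u')) * h4
  intro l hl hne
  have hne' : A ((l : ℤ) + 1) - A (l : ℤ) ≠ 0 := sub_ne_zero.mpr hne
  set q := (γ * δ) ^ (2 * N - 1) / γ ^ (4 * N - 2) with hq
  have m1 := hU (2 * (l : ℤ))
  have m2 := hU (2 * (l : ℤ) + 1)
  have m3 := hα (2 * (l : ℤ))
  obtain ⟨C, hC⟩ : ∃ C, C = α (2 * (l : ℤ)) * U (2 * (l : ℤ)) * γ ^ (4 * l) / U (2 * (l : ℤ) + 1) :=
    ⟨_, rfl⟩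
  have s1 : ∑ k ∈ Finset.Ico (l + 1) N,
              (α (2 * (l : ℤ)) * U (2 * (k : ℤ) + 1) * U (2 * (l : ℤ))
                  / (α (2 * (k : ℤ)) * γ ^ (4 * (k - l)) * U (2 * (l : ℤ) + 1) * U (2 * (k : ℤ))))
                * (1 - α (2 * (k : ℤ)) * U (2 * (k : ℤ))
                    / (α (2 * (k : ℤ) + 1) * γ ^ 2 * U (2 * (k : ℤ) + 2)))
      = -C * (A (N : ℤ) - A ((l + 1 : ℕ) : ℤ)) := by
    rw [← Finset.sum_Ico_sub (fun k : ℕ => A (k : ℤ)) (by omega : l + 1 ≤ N), Finset.mul_sum]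
    refine Finset.sum_congr rfl fun k hk => ?_
    have hk' := (Finset.mem_Ico.mp hk).1
    have n1 := hU (2 * (k : ℤ))
    have n5 := hα (2 * (k : ℤ))
    have e : γ ^ (4 * (k - l)) = γ ^ (4 * k) / γ ^ (4 * l) := by
      rw [Nat.mul_sub, pow_sub₀ _ hγ (by omega), div_eq_mul_inv]
    rw [neg_mul, ← mul_neg, neg_sub, ← key k, ← mul_assoc, e, hC]
    congr 1
    field_simp
  have s2 : ∑ k ∈ Finset.range l,
                (α (2 * (l : ℤ)) * γ ^ (4 * (l - k)) * U (2 * (k : ℤ) + 1) * U (2 * (l : ℤ))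
                    / (α (2 * (k : ℤ)) * U (2 * (l : ℤ) + 1) * U (2 * (k : ℤ))))
                  * (1 - α (2 * (k : ℤ)) * U (2 * (k : ℤ))
                      / (α (2 * (k : ℤ) + 1) * γ ^ 2 * U (2 * (k : ℤ) + 2)))
      = -C * (A (l : ℤ) - A ((0 : ℕ) : ℤ)) := by
    rw [← Finset.sum_range_sub (fun k : ℕ => A (k : ℤ)) l, Finset.mul_sum]
    refine Finset.sum_congr rfl fun k hk => ?_
    have hk' := Finset.mem_range.mp hk
    have n1 := hU (2 * (k : ℤ))
    have n5 := hα (2 * (k : ℤ))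
    have e : γ ^ (4 * (l - k)) = γ ^ (4 * l) / γ ^ (4 * k) := by
      rw [Nat.mul_sub, pow_sub₀ _ hγ (by omega), div_eq_mul_inv]
    rw [neg_mul, ← mul_neg, neg_sub, ← key k, ← mul_assoc, e, hC]
    congr 1
    field_simp
  have s3 : (α (2 * (l : ℤ)) * U (2 * (N : ℤ) + 1) * U (2 * (l : ℤ))
                / (α (2 * (N : ℤ)) * γ ^ (4 * (N - l)) * U (2 * (l : ℤ) + 1) * U 0))
              * (α (2 * (N : ℤ)) * β₀ * γ + U 0 / U (2 * (N : ℤ)))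
      = C * (A (N : ℤ) - q * A ((0 : ℕ) : ℤ)) := by
    have n1 := hU 0
    have n5 := hα (2 * (N : ℤ))
    have e : γ ^ (4 * (N - l)) = γ ^ (4 * N) / γ ^ (4 * l) := by
      rw [Nat.mul_sub, pow_sub₀ _ hγ (by omega), div_eq_mul_inv]
    rw [← last, ← mul_assoc, e, hC]
    congr 1
    field_simp
  have s4 : (1 - α (2 * (l : ℤ)) * U (2 * (l : ℤ))
            / (α (2 * (l : ℤ) + 1) * γ ^ 2 * U (2 * (l : ℤ) + 2)))
      = -C * (A ((l : ℤ) + 1) - A (l : ℤ)) := by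
    have := key l
    push_cast at this
    rw [neg_mul, ← mul_neg, neg_sub, ← this, ← mul_assoc, hC]
    symm
    convert one_mul _ using 2
    field_simp
  rw [s1, s2, s3, s4]
  push_cast
  field_simp
  ring
end

section
/- Consistency around the cube for the even cube C^{(e)}: suppose the eight values satisfy the four face equations (𝓐) U11/U00 + γ⁴·U01/U10 + αβγ = 0, (𝓑) U01/V00 = V01/U00, (𝓒) U00/V10 = (γ³/δ³)·(V00/U10 − δ³(γ−δ)/(α·ε^{l−2m})), and (𝓐') V11/V00 + δ⁴·V01/V10 + αβδ = 0. Then the remaining two face equations also hold: (𝓑') U11/V10 = (γ⁴/δ⁴)·(V11/U10 + β·δ⁴·(γ−δ)/ε^{l−2m}) and (𝓒') δ·U01·(U11/V01 + γ(γ−δ)/(α·ε^{l−2m−3})) = γ·V11. -/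
/-- Consistency around the cube for the even cube `C⁽ᵉ⁾`: the face equations
𝓐, 𝓑, 𝓒, 𝓐' imply the remaining face equations 𝓑' and 𝓒'. -/
theorem stmt_14 (l m : ℤ) (hlm : Even (l + m))
    (α β γ δ : ℂ) (hα : α ≠ 0) (hβ : β ≠ 0) (hγ : γ ≠ 0) (hδ : δ ≠ 0) (hγδ : γ ≠ δ)
    (U00 U10 U01 U11 V00 V10 V01 V11 : ℂ)
    (hU00 : U00 ≠ 0) (hU10 : U10 ≠ 0) (hU01 : U01 ≠ 0) (hU11 : U11 ≠ 0)
    (hV00 : V00 ≠ 0) (hV10 : V10 ≠ 0) (hV01 : V01 ≠ 0) (hV11 : V11 ≠ 0)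
    (hfA : U11 / U00 + γ ^ 4 * U01 / U10 + α * β * γ = 0)
    (hfB : U01 / V00 = V01 / U00)
    (hfC : U00 / V10
      = (γ ^ 3 / δ ^ 3) * (V00 / U10 - δ ^ 3 * (γ - δ) / (α * (γ * δ) ^ (l - 2 * m))))
    (hfA' : V11 / V00 + δ ^ 4 * V01 / V10 + α * β * δ = 0) :
    (U11 / V10
      = (γ ^ 4 / δ ^ 4) * (V11 / U10 + β * δ ^ 4 * (γ - δ) / (γ * δ) ^ (l - 2 * m))) ∧
    (δ * U01 * (U11 / V01 + γ * (γ - δ) / (α * (γ * δ) ^ (l - 2 * m - 3))) = γ * V11) := by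
  have hε : γ * δ ≠ 0 := mul_ne_zero hγ hδ
  have hz : (γ * δ) ^ (l - 2 * m - 3) = (γ * δ) ^ (l - 2 * m) / (γ * δ) ^ 3 := by
    rw [zpow_sub₀ hε]; norm_cast
  rw [hz]
  have hE : (γ * δ) ^ (l - 2 * m) ≠ 0 := zpow_ne_zero _ hε
  generalize (γ * δ) ^ (l - 2 * m) = E at *
  have e1 : U11 = -U00 * (γ ^ 4 * U01 / U10 + α * β * γ) := by
    have : U11 = U00 * (U11 / U00) := by field_simp
    rw [this]; linear_combination U00 * hfA
  have e2 : V11 = -V00 * (δ ^ 4 * V01 / V10 + α * β * δ) := by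
    have : V11 = V00 * (V11 / V00) := by field_simp
    rw [this]; linear_combination V00 * hfA'
  have e3 : V01 = U00 * U01 / V00 := by
    field_simp at hfB ⊢
    linear_combination -hfB
  have e4 : V10⁻¹ = (γ ^ 3 / δ ^ 3) * (V00 / U10 - δ ^ 3 * (γ - δ) / (α * E)) / U00 := by
    rw [← hfC]; field_simp
  clear hfA hfB hfC hfA' hz
  constructor
  · rw [e1, e2, e3]
    simp only [div_eq_mul_inv _ V10, e4]
    field_simp
    ring
  · rw [e1, e2, e3]
    simp only [div_eq_mul_inv _ V10, e4]
    field_simp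
    ring
end

section
/- Consistency around the cube for the odd cube C^{(o)}: suppose the eight values satisfy the four face equations (𝓐) U11/U00 + U01/(γ⁴·U10) + αβ/γ = 0, (𝓑) U01/V00 = (γ⁴/δ⁴)·(V01/U00 + β·δ⁴·(γ−δ)/ε^{l−2m−1}), (𝓒) δ·U00·(U10/V00 + γ(γ−δ)/(α·ε^{l−2m−1})) = γ·V10, and (𝓐') V11/V00 + V01/(δ⁴·V10) + αβ/δ = 0. Then the remaining two face equations also hold: (𝓑') U11/V10 = V11/U10 and (𝓒') U01/V11 = (γ³/δ³)·(V01/U11 − δ³(γ−δ)/(α·ε^{l−2m−2})). -/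
/-- Consistency around the cube for the odd cube `C⁽ᵒ⁾`: the face equations
𝓐, 𝓑, 𝓒, 𝓐' imply the remaining face equations 𝓑' and 𝓒'. -/
theorem stmt_15 (l m : ℤ) (hlm : ¬ Even (l + m))
    (α β γ δ : ℂ) (hα : α ≠ 0) (hβ : β ≠ 0) (hγ : γ ≠ 0) (hδ : δ ≠ 0) (hγδ : γ ≠ δ)
    (U00 U10 U01 U11 V00 V10 V01 V11 : ℂ)
    (hU00 : U00 ≠ 0) (hU10 : U10 ≠ 0) (hU01 : U01 ≠ 0) (hU11 : U11 ≠ 0)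
    (hV00 : V00 ≠ 0) (hV10 : V10 ≠ 0) (hV01 : V01 ≠ 0) (hV11 : V11 ≠ 0)
    (hfA : U11 / U00 + U01 / (γ ^ 4 * U10) + α * β / γ = 0)
    (hfB : U01 / V00
      = (γ ^ 4 / δ ^ 4) * (V01 / U00 + β * δ ^ 4 * (γ - δ) / (γ * δ) ^ (l - 2 * m - 1)))
    (hfC : δ * U00 * (U10 / V00 + γ * (γ - δ) / (α * (γ * δ) ^ (l - 2 * m - 1))) = γ * V10)
    (hfA' : V11 / V00 + V01 / (δ ^ 4 * V10) + α * β / δ = 0) :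
    (U11 / V10 = V11 / U10) ∧
    (U01 / V11
      = (γ ^ 3 / δ ^ 3) * (V01 / U11 - δ ^ 3 * (γ - δ) / (α * (γ * δ) ^ (l - 2 * m - 2)))) := by
  have hε : γ * δ ≠ 0 := mul_ne_zero hγ hδ
  have hE2 : (γ * δ) ^ (l - 2 * m - 2) = (γ * δ) ^ (l - 2 * m - 1) / (γ * δ) := by
    rw [show l - 2 * m - 2 = (l - 2 * m - 1) - 1 by ring, zpow_sub_one₀ hε, div_eq_mul_inv]
  rw [hE2]
  have hE : (γ * δ) ^ (l - 2 * m - 1) ≠ 0 := zpow_ne_zero _ hε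
  generalize (γ * δ) ^ (l - 2 * m - 1) = E at *
  clear hE2
  obtain ⟨k, hk⟩ : ∃ k, k = (γ - δ) / E := ⟨_, rfl⟩
  have hkE : γ - δ = k * E := by rw [hk]; field_simp
  rw [hkE] at hfB hfC ⊢
  have hA : U01 = - γ ^ 4 * U10 * (U11 / U00 + α * β / γ) := by
    have : U01 = γ ^ 4 * U10 * (U01 / (γ ^ 4 * U10)) := by field_simp
    rw [this]; linear_combination γ ^ 4 * U10 * hfA
  have hA' : V01 = - δ ^ 4 * V10 * (V11 / V00 + α * β / δ) := by
    have : V01 = δ ^ 4 * V10 * (V01 / (δ ^ 4 * V10)) := by field_simp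
    rw [this]; linear_combination δ ^ 4 * V10 * hfA'
  have hC : γ * V10 * V00 * α = δ * U00 * U10 * α + k * γ * δ * U00 * V00 := by
    rw [← hfC]; field_simp
  have hB : U01 * U00 / γ ^ 4 = V00 * V01 / δ ^ 4 + β * k * V00 * U00 := by
    have h1 : U01 * U00 / γ ^ 4 = (U01 / V00) * (V00 * U00 / γ ^ 4) := by field_simp
    rw [h1, hfB]; field_simp
  have hP : U10 * U11 = V10 * V11 := by
    rw [hA, hA'] at hB
    have h1 : -γ ^ 4 * U10 * (U11 / U00 + α * β / γ) * U00 / γ ^ 4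
        = - (U10 * U11) - α * β * U10 * U00 / γ := by field_simp; ring
    have h2 : V00 * (-δ ^ 4 * V10 * (V11 / V00 + α * β / δ)) / δ ^ 4
        = - (V10 * V11) - α * β * V10 * V00 / δ := by field_simp; ring
    have h3 : α * β * V10 * V00 / δ = α * β * U10 * U00 / γ + β * k * V00 * U00 := by
      field_simp
      linear_combination hC
    rw [h1, h2] at hB
    linear_combination -hB + h3
  refine ⟨?_, ?_⟩
  · rw [div_eq_div_iff hV10 hU10]; linear_combination hP
  · have key : U01 * U11 / γ ^ 3 = V01 * V11 / δ ^ 3 - k * γ * δ / α * U11 * V11 := by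
      have h1 : U01 * U11 / γ ^ 3 = - γ * (U10 * U11) * U11 / U00 - α * β * (U10 * U11) := by
        rw [hA]; field_simp; ring
      have h2 : V01 * V11 / δ ^ 3 = - δ * (U10 * U11) * V11 / V00 - α * β * (U10 * U11) := by
        rw [hP, hA']; field_simp; ring
      have h3 : γ * (U10 * U11) * U11 / U00
          = δ * (U10 * U11) * V11 / V00 + k * γ * δ / α * U11 * V11 := by
        have h4 : γ * (U10 * U11) * U11 / U00 = γ * V10 * V00 * α * (V11 * U11 / (U00 * V00 * α)) := by
          rw [hP]; field_simp
        rw [h4, hC]; field_simp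
      rw [h1, h2]
      linear_combination -h3
    have h5 : U01 / V11 = (U01 * U11 / γ ^ 3) * (γ ^ 3 / (U11 * V11)) := by field_simp
    rw [h5, key]; field_simp
end

section
/- Tetrahedron property of the even cube C^{(e)}: if the eight values satisfy all six face equations 𝓐, 𝓐', 𝓑, 𝓑', 𝓒, 𝓒' of the even cube, then the two tetrahedron relations hold: (T1) U10·U01 − (α·ε^{l−2m−3}/(δ·(γ−δ)))·( U10·V11 + γ²ε·U01·V00 + αβδ·U10·V00 ) = 0; and (T2) V10·V01 + (α·ε^{l−2m−3}/(γ·(γ−δ)))·( U11·V10 + δ²ε·U00·V01 + αβγ·U00·V10 ) = 0. -/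
/-- Tetrahedron property of the even cube `C⁽ᵉ⁾`: the six face equations imply
the two tetrahedron relations. -/
theorem stmt_16 (l m : ℤ) (hlm : Even (l + m))
    (α β γ δ : ℂ) (hα : α ≠ 0) (hβ : β ≠ 0) (hγ : γ ≠ 0) (hδ : δ ≠ 0) (hγδ : γ ≠ δ)
    (U00 U10 U01 U11 V00 V10 V01 V11 : ℂ)
    (hU00 : U00 ≠ 0) (hU10 : U10 ≠ 0) (hU01 : U01 ≠ 0) (hU11 : U11 ≠ 0)
    (hV00 : V00 ≠ 0) (hV10 : V10 ≠ 0) (hV01 : V01 ≠ 0) (hV11 : V11 ≠ 0)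
    (hfA : U11 / U00 + γ ^ 4 * U01 / U10 + α * β * γ = 0)
    (hfA' : V11 / V00 + δ ^ 4 * V01 / V10 + α * β * δ = 0)
    (hfB : U01 / V00 = V01 / U00)
    (hfB' : U11 / V10
      = (γ ^ 4 / δ ^ 4) * (V11 / U10 + β * δ ^ 4 * (γ - δ) / (γ * δ) ^ (l - 2 * m)))
    (hfC : U00 / V10
      = (γ ^ 3 / δ ^ 3) * (V00 / U10 - δ ^ 3 * (γ - δ) / (α * (γ * δ) ^ (l - 2 * m))))
    (hfC' : δ * U01 * (U11 / V01 + γ * (γ - δ) / (α * (γ * δ) ^ (l - 2 * m - 3))) = γ * V11) :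
    (U10 * U01 - α * (γ * δ) ^ (l - 2 * m - 3) / (δ * (γ - δ))
        * (U10 * V11 + γ ^ 2 * (γ * δ) * U01 * V00 + α * β * δ * U10 * V00) = 0) ∧
    (V10 * V01 + α * (γ * δ) ^ (l - 2 * m - 3) / (γ * (γ - δ))
        * (U11 * V10 + δ ^ 2 * (γ * δ) * U00 * V01 + α * β * γ * U00 * V10) = 0) := by
  have hε : γ * δ ≠ 0 := mul_ne_zero hγ hδ
  have hκ : γ - δ ≠ 0 := sub_ne_zero.mpr hγδ
  have hE0 : (γ * δ) ^ (l - 2 * m - 3) ≠ 0 := zpow_ne_zero _ hε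
  have hpow : (γ * δ) ^ (l - 2 * m) = (γ * δ) ^ (l - 2 * m - 3) * (γ * δ) ^ 3 := by
    rw [← zpow_natCast, ← zpow_add₀ hε]
    congr 1
    push_cast
    ring
  rw [hpow] at hfC
  clear hfB' hfC' hpow
  generalize (γ * δ) ^ (l - 2 * m - 3) = E at *
  have A : U11 * U10 + γ ^ 4 * U01 * U00 + α * β * γ * U00 * U10 = 0 := by
    have h : U11 * U10 + γ ^ 4 * U01 * U00 + α * β * γ * U00 * U10
        = (U11 / U00 + γ ^ 4 * U01 / U10 + α * β * γ) * (U00 * U10) := by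
      field_simp
    rw [h, hfA, zero_mul]
  have A' : V11 * V10 + δ ^ 4 * V01 * V00 + α * β * δ * V00 * V10 = 0 := by
    have h : V11 * V10 + δ ^ 4 * V01 * V00 + α * β * δ * V00 * V10
        = (V11 / V00 + δ ^ 4 * V01 / V10 + α * β * δ) * (V00 * V10) := by
      field_simp
    rw [h, hfA', zero_mul]
  have B : U01 * U00 = V01 * V00 := (div_eq_div_iff hV00 hU00).mp hfB
  have C : α * E * (δ ^ 3 * U00 * U10 - γ ^ 3 * V00 * V10) = - (γ - δ) * U10 * V10 := by
    have h1 : α * E * δ ^ 3 * U00 * U10 = (U00 / V10) * (α * E * δ ^ 3 * U10 * V10) := by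
      field_simp
    have h2 : (γ ^ 3 / δ ^ 3) * (V00 / U10 - δ ^ 3 * (γ - δ) / (α * (E * (γ * δ) ^ 3)))
        * (α * E * δ ^ 3 * U10 * V10)
        = α * E * γ ^ 3 * V00 * V10 - (γ - δ) * U10 * V10 := by
      field_simp
    rw [hfC, h2] at h1
    linear_combination h1
  constructor
  · have h : U10 * U01 * (δ * (γ - δ))
        = α * E * (U10 * V11 + γ ^ 2 * (γ * δ) * U01 * V00 + α * β * δ * U10 * V00) := by
      apply mul_right_cancel₀ hV10
      linear_combination (δ * U01) * C - α * E * U10 * A' - α * E * δ ^ 4 * U10 * B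
    rw [div_mul_eq_mul_div, ← h, mul_div_cancel_right₀ _ (mul_ne_zero hδ hκ), sub_self]
  · have h : α * E * (U11 * V10 + δ ^ 2 * (γ * δ) * U00 * V01 + α * β * γ * U00 * V10)
        = -(V10 * V01) * (γ * (γ - δ)) := by
      apply mul_right_cancel₀ hU10
      linear_combination (γ * V01) * C + α * E * V10 * A - α * E * γ ^ 4 * V10 * B
    rw [div_mul_eq_mul_div, h, mul_div_cancel_right₀ _ (mul_ne_zero hγ hκ), add_neg_cancel]
end

section
/- Tetrahedron property of the odd cube C^{(o)}: if the eight values satisfy all six face equations 𝓐, 𝓐', 𝓑, 𝓑', 𝓒, 𝓒' of the odd cube, then the two tetrahedron relations hold: (T1) V00·V11 + (α·ε^{l−2m−2}/(γ³·(γ−δ)))·( U01·V00 + γ²ε·U10·V11 + αβγ³·U10·V00 ) = 0; and (T2) U00·U11 − (α·ε^{l−2m−2}/(δ³·(γ−δ)))·( U00·V01 + δ²ε·U11·V10 + αβδ³·U00·V10 ) = 0. -/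
/-- Tetrahedron property of the odd cube `C⁽ᵒ⁾`: the six face equations imply
the two tetrahedron relations. -/
theorem stmt_17 (l m : ℤ) (hlm : ¬ Even (l + m))
    (α β γ δ : ℂ) (hα : α ≠ 0) (hβ : β ≠ 0) (hγ : γ ≠ 0) (hδ : δ ≠ 0) (hγδ : γ ≠ δ)
    (U00 U10 U01 U11 V00 V10 V01 V11 : ℂ)
    (hU00 : U00 ≠ 0) (hU10 : U10 ≠ 0) (hU01 : U01 ≠ 0) (hU11 : U11 ≠ 0)
    (hV00 : V00 ≠ 0) (hV10 : V10 ≠ 0) (hV01 : V01 ≠ 0) (hV11 : V11 ≠ 0)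
    (hfA : U11 / U00 + U01 / (γ ^ 4 * U10) + α * β / γ = 0)
    (hfA' : V11 / V00 + V01 / (δ ^ 4 * V10) + α * β / δ = 0)
    (hfB : U01 / V00
      = (γ ^ 4 / δ ^ 4) * (V01 / U00 + β * δ ^ 4 * (γ - δ) / (γ * δ) ^ (l - 2 * m - 1)))
    (hfB' : U11 / V10 = V11 / U10)
    (hfC : δ * U00 * (U10 / V00 + γ * (γ - δ) / (α * (γ * δ) ^ (l - 2 * m - 1))) = γ * V10)
    (hfC' : U01 / V11
      = (γ ^ 3 / δ ^ 3) * (V01 / U11 - δ ^ 3 * (γ - δ) / (α * (γ * δ) ^ (l - 2 * m - 2)))) :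
    (V00 * V11 + α * (γ * δ) ^ (l - 2 * m - 2) / (γ ^ 3 * (γ - δ))
        * (U01 * V00 + γ ^ 2 * (γ * δ) * U10 * V11 + α * β * γ ^ 3 * U10 * V00) = 0) ∧
    (U00 * U11 - α * (γ * δ) ^ (l - 2 * m - 2) / (δ ^ 3 * (γ - δ))
        * (U00 * V01 + δ ^ 2 * (γ * δ) * U11 * V10 + α * β * δ ^ 3 * U00 * V10) = 0) := by
  have hε : γ * δ ≠ 0 := mul_ne_zero hγ hδ
  have hd : γ - δ ≠ 0 := sub_ne_zero.mpr hγδ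
  have hpow : (γ * δ) ^ (l - 2 * m - 1) = (γ * δ) ^ (l - 2 * m - 2) * (γ * δ) := by
    rw [← zpow_add_one₀ hε]; congr 1; ring
  have hE : (γ * δ) ^ (l - 2 * m - 2) ≠ 0 := zpow_ne_zero _ hε
  rw [hpow] at hfC
  clear hfB hfC' hpow
  generalize (γ * δ) ^ (l - 2 * m - 2) = E at *
  have A : γ ^ 4 * U11 * U10 + U01 * U00 + α * β * γ ^ 3 * U10 * U00 = 0 := by
    have h : γ ^ 4 * U11 * U10 + U01 * U00 + α * β * γ ^ 3 * U10 * U00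
      = (U11 / U00 + U01 / (γ ^ 4 * U10) + α * β / γ) * (γ ^ 4 * U10 * U00) := by
      field_simp
    rw [h, hfA, zero_mul]
  have A' : δ ^ 4 * V11 * V10 + V01 * V00 + α * β * δ ^ 3 * V10 * V00 = 0 := by
    have h : δ ^ 4 * V11 * V10 + V01 * V00 + α * β * δ ^ 3 * V10 * V00
      = (V11 / V00 + V01 / (δ ^ 4 * V10) + α * β / δ) * (δ ^ 4 * V10 * V00) := by
      field_simp
    rw [h, hfA', zero_mul]
  have B : U11 * U10 = V11 * V10 := (div_eq_div_iff hV10 hU10).mp hfB'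
  have C : α * E * δ * U00 * U10 + U00 * V00 * (γ - δ) = α * E * γ * V10 * V00 := by
    have h : α * E * δ * U00 * U10 + U00 * V00 * (γ - δ)
      = (δ * U00 * (U10 / V00 + γ * (γ - δ) / (α * (E * (γ * δ))))) * (α * E * V00) := by
      field_simp
    rw [h, hfC]; ring
  constructor
  · have h : V00 * V11 + α * E / (γ ^ 3 * (γ - δ))
        * (U01 * V00 + γ ^ 2 * (γ * δ) * U10 * V11 + α * β * γ ^ 3 * U10 * V00)
        = ((γ ^ 3 * (γ - δ) * V00 * V11 + α * E * (U01 * V00 + γ ^ 2 * (γ * δ) * U10 * V11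
          + α * β * γ ^ 3 * U10 * V00)) * U00) / (γ ^ 3 * (γ - δ) * U00) := by
      field_simp
    rw [h, div_eq_zero_iff]
    left
    linear_combination γ ^ 3 * V11 * C + α * E * V00 * A - α * E * V00 * γ ^ 4 * B
  · have h : U00 * U11 - α * E / (δ ^ 3 * (γ - δ))
        * (U00 * V01 + δ ^ 2 * (γ * δ) * U11 * V10 + α * β * δ ^ 3 * U00 * V10)
        = ((δ ^ 3 * (γ - δ) * U00 * U11 - α * E * (U00 * V01 + δ ^ 2 * (γ * δ) * U11 * V10
          + α * β * δ ^ 3 * U00 * V10)) * V00) / (δ ^ 3 * (γ - δ) * V00) := by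
      field_simp
    rw [h, div_eq_zero_iff]
    left
    linear_combination δ ^ 3 * U11 * C - α * E * U00 * A' - α * E * U00 * δ ^ 4 * B
end

section
/- Then: (i) for every l ∈ ℤ, x_{l+2h}·x_l = −p²·α²·κ(l)²·(y_l + 1)/y_l²; and (ii) there exists a nonzero complex number t₀ such that, setting q = p² and t_l = q^l·t₀, the 4h-th order q-difference relation y_{l+2h}·y_l = t_l·∏_{k=1}^{2h−1} (y_{l+k} + 1)/y_{l+k}² holds for every l ∈ ℤ. (This is the reduction of the (1,2h)-pair to the Painlevé-type q-difference equation (B.14) of the paper; for h = 1 it is a q-Painlevé I equation of A₇^{(1)}-surface type.) -/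
open Finset

/-- Reduction of the `(1,2h)`-pair to the Painlevé-type `q`-difference equation
(B.14) of the paper (a `q`-Painlevé I equation of `A₇⁽¹⁾`-surface type for `h = 1`). -/
theorem stmt_18 (h : ℕ) (hh : 1 ≤ h)
    (p α : ℂ) (hp : p ≠ 0) (hα : α ≠ 0)
    (κ : ℤ → ℂ) (hκ : ∀ l, κ l ≠ 0)
    (hκp : ∀ l : ℤ, κ (l + 2 * (h : ℤ)) = p * κ l)
    (U : ℤ → ℂ) (hU : ∀ l, U l ≠ 0)
    (hUeq : ∀ l : ℤ,
      U (l + 2 * (h : ℤ) + 1) / U l + U (l + 1) / U (l + 2 * (h : ℤ)) + p * α * κ l = 0)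
    (x y : ℤ → ℂ)
    (hx : ∀ l : ℤ, x l = U (l + 1) / U l)
    (hy : ∀ l : ℤ, y l = p * α * κ l * ∏ k ∈ Finset.range (2 * h - 1), x (l + (k : ℤ) + 1))
    (hy0 : ∀ l, y l ≠ 0) :
    (∀ l : ℤ,
      x (l + 2 * (h : ℤ)) * x l = -(p ^ 2 * α ^ 2 * (κ l) ^ 2 * (y l + 1) / (y l) ^ 2)) ∧
    (∃ t₀ : ℂ, t₀ ≠ 0 ∧ ∀ l : ℤ,
      y (l + 2 * (h : ℤ)) * y l
        = (p ^ 2) ^ l * t₀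
          * ∏ k ∈ Finset.range (2 * h - 1), (y (l + (k : ℤ) + 1) + 1) / (y (l + (k : ℤ) + 1)) ^ 2) := by
  obtain ⟨n, hn⟩ : ∃ n, 2 * h = n + 1 := ⟨2 * h - 1, by omega⟩
  have hn' : 2 * h - 1 = n := by omega
  have hnz : 2 * (h : ℤ) = (n : ℤ) + 1 := by exact_mod_cast hn
  have hodd : Odd n := by
    rw [Nat.odd_iff]; omega
  simp only [hn'] at hy ⊢
  simp only [hnz] at hκp hUeq ⊢
  have tel : ∀ (l : ℤ) (m : ℕ),
      ∏ k ∈ Finset.range m, x (l + (k : ℤ) + 1) = U (l + m + 1) / U (l + 1) := by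
    intro l m
    induction m with
    | zero => simp [hU]
    | succ m ih =>
      rw [Finset.prod_range_succ, ih, hx]
      have e : l + ((m + 1 : ℕ) : ℤ) + 1 = l + (m : ℤ) + 1 + 1 := by push_cast; ring
      rw [e]
      have := hU (l + m + 1)
      have := hU (l + 1)
      field_simp
  have h1 : ∀ l : ℤ,
      x (l + ((n : ℤ) + 1)) * x l
        = -(p ^ 2 * α ^ 2 * (κ l) ^ 2 * (y l + 1) / (y l) ^ 2) := by
    intro l
    have e := hUeq l
    have e0 : l + ((n : ℤ) + 1) = l + n + 1 := by ring
    rw [hy l, tel, hx, hx l]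
    rw [e0] at e ⊢
    have a1 := hU l
    have a2 := hU (l + 1)
    have a3 := hU (l + n + 1)
    have a4 := hκ l
    generalize U (l + n + 1 + 1) = A at *
    generalize U (l + n + 1) = B at *
    generalize U (l + 1) = C at *
    generalize U l = D at *
    generalize κ l = K at *
    field_simp at e ⊢
    linear_combination e
  refine ⟨h1, ?_⟩
  set P : ℤ → ℂ := fun l => ∏ k ∈ Finset.range (n + 1), (p * α * κ (l + k)) with hP
  have hP0 : ∀ l, P l ≠ 0 := fun l =>
    Finset.prod_ne_zero_iff.mpr fun k _ => mul_ne_zero (mul_ne_zero hp hα) (hκ _)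
  have hsh : ∀ l, P l = p * α * κ l * ∏ k ∈ Finset.range n, (p * α * κ (l + (k : ℤ) + 1)) := by
    intro l
    simp only [hP]
    rw [Finset.prod_range_succ', mul_comm]
    congr 1
    · simp
    · refine Finset.prod_congr rfl fun k _ => ?_
      push_cast
      rw [add_assoc]
  have hPs : ∀ l, P (l + 1) = p * P l := by
    intro l
    rw [hsh l]
    simp only [hP]
    rw [Finset.prod_range_succ]
    have e : l + 1 + (n : ℤ) = l + ((n : ℤ) + 1) := by ring
    rw [e, hκp]
    have e2 : ∏ k ∈ Finset.range n, (p * α * κ (l + 1 + (k : ℤ)))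
        = ∏ k ∈ Finset.range n, (p * α * κ (l + (k : ℤ) + 1)) :=
      Finset.prod_congr rfl fun k _ => by rw [add_right_comm]
    rw [e2]
    ring
  have hPl : ∀ l : ℤ, P l = p ^ l * P 0 := by
    intro l
    induction l using Int.induction_on with
    | zero => simp
    | succ i ih => rw [hPs, ih, zpow_add_one₀ hp]; ring
    | pred i ih =>
      have := hPs (-(i : ℤ) - 1)
      rw [sub_add_cancel, ih] at this
      rw [zpow_sub_one₀ hp]
      field_simp
      linear_combination -this
  refine ⟨-p * P 0 ^ 2, mul_ne_zero (neg_ne_zero.mpr hp) (pow_ne_zero _ (hP0 0)), fun l => ?_⟩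
  have ht : (p ^ 2) ^ l * (-p * P 0 ^ 2) = -p * P l ^ 2 := by
    rw [hPl l, ← zpow_natCast p 2, ← zpow_mul, mul_comm ((2 : ℕ) : ℤ) l, zpow_mul, zpow_natCast]
    ring
  have hprod : (∏ k ∈ Finset.range n, x (l + ((n : ℤ) + 1) + (k : ℤ) + 1))
      * ∏ k ∈ Finset.range n, x (l + (k : ℤ) + 1)
      = -((∏ k ∈ Finset.range n, (p * α * κ (l + (k : ℤ) + 1))) ^ 2
        * ∏ k ∈ Finset.range n, (y (l + (k : ℤ) + 1) + 1) / (y (l + (k : ℤ) + 1)) ^ 2) := by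
    rw [← Finset.prod_mul_distrib, ← Finset.prod_pow, ← Finset.prod_mul_distrib]
    have hm : (-1 : ℂ) = ∏ _k ∈ Finset.range n, (-1 : ℂ) := by
      simp [hodd.neg_one_pow]
    rw [← neg_one_mul (∏ k ∈ Finset.range n, _), hm, ← Finset.prod_mul_distrib]
    refine Finset.prod_congr rfl fun k _ => ?_
    have e : l + ((n : ℤ) + 1) + (k : ℤ) + 1 = (l + (k : ℤ) + 1) + ((n : ℤ) + 1) := by ring
    rw [e, h1]
    ring
  rw [ht, hsh l, hy (l + ((n : ℤ) + 1)), hκp, hy l]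
  linear_combination (p * (p * α * κ l) ^ 2) * hprod
end

section
/- Then there exists a nonzero complex number t₀ such that, setting c = λ₀^{4h+1} and t_l = q^l·t₀, the relation y_{l+2h}·y_l = c^{(−1)^l}·t_l·( ∏_{k=0}^{h−1} (y_{l+2k+1} + 1) ) / ( ∏_{k=1}^{2h−1} y_{l+k} ) holds for every l ∈ ℤ, where c^{(−1)^l} means c if l is even and c⁻¹ if l is odd. (This is the reduction of the (1,2h+1)-pair to the Painlevé-type q-difference equation (B.21) of the paper; for h = 1 it is a q-Painlevé II equation of A₆^{(1)}-surface type.) -/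
open Finset

/-- Reduction of the `(1,2h+1)`-pair to the Painlevé-type `q`-difference equation
(B.21) of the paper (a `q`-Painlevé II equation of `A₆⁽¹⁾`-surface type for `h = 1`). -/
theorem stmt_19 (h : ℕ) (hh : 1 ≤ h)
    (q α Λ₀ : ℂ) (hq : q ≠ 0) (hα : α ≠ 0) (hΛ₀ : Λ₀ ≠ 0)
    (lam : ℤ → ℂ) (hlam : ∀ l : ℤ, lam l = if Even l then Λ₀ else Λ₀⁻¹)
    (κ : ℤ → ℂ) (hκ : ∀ l, κ l ≠ 0)
    (hκp : ∀ l : ℤ, κ (l + 2 * (h : ℤ) + 1) = q * κ l)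
    (U : ℤ → ℂ) (hU : ∀ l, U l ≠ 0)
    (hUeq : ∀ l : ℤ,
      U (l + 2 * (h : ℤ) + 2) / U l + (lam l) ^ 4 * U (l + 1) / U (l + 2 * (h : ℤ) + 1)
        + q * α * κ l * (lam l) ^ 3 = 0)
    (y : ℤ → ℂ)
    (hy : ∀ l : ℤ, y l = q * α * κ (l - 1) * lam l * U (l + 2 * (h : ℤ)) / U l)
    (hy0 : ∀ l, y l ≠ 0) :
    ∃ t₀ : ℂ, t₀ ≠ 0 ∧ ∀ l : ℤ,
      y (l + 2 * (h : ℤ)) * y l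
        = (if Even l then Λ₀ ^ (4 * h + 1) else (Λ₀ ^ (4 * h + 1))⁻¹) * (q ^ l * t₀)
          * (∏ k ∈ Finset.range h, (y (l + 2 * (k : ℤ) + 1) + 1))
          / ∏ k ∈ Finset.range (2 * h - 1), y (l + (k : ℤ) + 1) := by
  have hl0 : ∀ l, lam l ≠ 0 := by
    intro l; rw [hlam]; split_ifs
    · exact hΛ₀
    · exact inv_ne_zero hΛ₀
  have hl1 : ∀ l, lam (l + 1) = (lam l)⁻¹ := by
    intro l
    rw [hlam, hlam]
    by_cases he : Even l <;> simp [he, Int.even_add_one]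
  have hl2 : ∀ (l : ℤ) (n : ℕ), lam (l + 2 * (n : ℤ)) = lam l := by
    intro l n
    rw [hlam, hlam]
    simp [Int.even_add]
  have hy1 : ∀ l, (y (l + 1) + 1) * (U l * U (l + 1))
      = -((lam l)⁻¹ ^ 4) * (U (l + 2 * (h : ℤ) + 1) * U (l + 2 * (h : ℤ) + 1 + 1)) := by
    intro l
    have e := hUeq l
    have a := hU l
    have b := hU (l + 1)
    have c := hU (l + 2 * (h : ℤ) + 1)
    have d := hl0 l
    rw [hy, hl1]
    rw [show l + 1 - 1 = l by ring, show l + 1 + 2 * (h : ℤ) = l + 2 * (h : ℤ) + 1 by ring,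
      show l + 2 * (h : ℤ) + 1 + 1 = l + 2 * (h : ℤ) + 2 by ring]
    field_simp at e ⊢
    linear_combination e
  have P1 : ∀ (l : ℤ) (n : ℕ), (∏ k ∈ Finset.range n, (y (l + 2 * (k : ℤ) + 1) + 1))
      * ∏ j ∈ Finset.range (2 * n), U (l + (j : ℤ))
      = (-((lam l)⁻¹ ^ 4)) ^ n * ∏ j ∈ Finset.range (2 * n), U (l + 2 * (h : ℤ) + 1 + (j : ℤ)) := by
    intro l n
    induction n with
    | zero => simp
    | succ n ih =>
      have e := hy1 (l + 2 * (n : ℤ))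
      rw [hl2] at e
      rw [show 2 * (n + 1) = 2 * n + 1 + 1 by ring]
      simp only [Finset.prod_range_succ]
      push_cast
      rw [show l + (2 * (n : ℤ) + 1) = l + 2 * (n : ℤ) + 1 by ring,
        show l + 2 * (h : ℤ) + 1 + 2 * (n : ℤ) = l + 2 * (n : ℤ) + 2 * (h : ℤ) + 1 by ring,
        show l + 2 * (h : ℤ) + 1 + (2 * (n : ℤ) + 1)
          = l + 2 * (n : ℤ) + 2 * (h : ℤ) + 1 + 1 by ring, pow_succ]
      calc _ = ((∏ k ∈ Finset.range n, (y (l + 2 * (k : ℤ) + 1) + 1))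
            * ∏ j ∈ Finset.range (2 * n), U (l + (j : ℤ))) *
            ((y (l + 2 * (n : ℤ) + 1) + 1) * (U (l + 2 * (n : ℤ)) * U (l + 2 * (n : ℤ) + 1))) := by
              ring
        _ = _ := by rw [ih, e]; ring
  have PL : ∀ (l : ℤ) (n : ℕ), ∏ j ∈ Finset.range (2 * n + 1), lam (l + (j : ℤ)) = lam l := by
    intro l n
    induction n with
    | zero => simp
    | succ n ih =>
      rw [show 2 * (n + 1) + 1 = 2 * n + 1 + 1 + 1 by ring, Finset.prod_range_succ,
        Finset.prod_range_succ, ih]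
      push_cast
      have := hl0 l
      rw [← add_assoc, ← add_assoc,
        show l + 2 * (n : ℤ) + 2 = l + 2 * (n : ℤ) + 1 + 1 by ring,
        hl1 (l + 2 * (n : ℤ) + 1), hl1, hl2]
      field_simp
  have P2 : ∀ (l : ℤ) (n : ℕ), (∏ j ∈ Finset.range n, y (l + (j : ℤ)))
      * ∏ j ∈ Finset.range n, U (l + (j : ℤ))
      = (q * α) ^ n * (∏ j ∈ Finset.range n, κ (l + (j : ℤ) - 1))
        * (∏ j ∈ Finset.range n, lam (l + (j : ℤ)))
        * ∏ j ∈ Finset.range n, U (l + (j : ℤ) + 2 * (h : ℤ)) := by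
    intro l n
    rw [← Finset.prod_mul_distrib]
    induction n with
    | zero => simp
    | succ n ih =>
      simp only [Finset.prod_range_succ] at ih ⊢
      rw [ih, hy]
      have := hU (l + (n : ℤ))
      field_simp
      ring
  obtain ⟨K, hK⟩ : ∃ K : ℤ → ℂ, ∀ l, K l = ∏ j ∈ Finset.range (2 * h + 1), κ (l + (j : ℤ) - 1) :=
    ⟨_, fun _ => rfl⟩
  have hK0 : ∀ l, K l ≠ 0 := by
    intro l; rw [hK]; exact Finset.prod_ne_zero_iff.mpr fun _ _ => hκ _
  have hK1 : ∀ l, K (l + 1) = q * K l := by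
    intro l
    rw [hK, hK, Finset.prod_range_succ, Finset.prod_range_succ']
    push_cast
    have e := hκp (l - 1)
    rw [show l + 1 + 2 * (h : ℤ) - 1 = l - 1 + 2 * (h : ℤ) + 1 by ring, e]
    have : ∀ j : ℕ, l + 1 + (j : ℤ) - 1 = l + ((j : ℤ) + 1) - 1 := fun j => by ring
    simp only [this, add_zero]
    ring
  have hKq : ∀ l : ℤ, K l = q ^ l * K 0 := by
    intro l
    induction l using Int.induction_on with
    | zero => simp
    | succ i ih => rw [hK1, ih, zpow_add_one₀ hq]; ring
    | pred i ih =>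
      have e := hK1 (-(i : ℤ) - 1)
      rw [sub_add_cancel, ih] at e
      rw [zpow_sub_one₀ hq]
      field_simp
      linear_combination -e
  refine ⟨(-1) ^ h * (q * α) ^ (2 * h + 1) * K 0, ?_, ?_⟩
  · exact mul_ne_zero (mul_ne_zero (pow_ne_zero _ (by norm_num))
      (pow_ne_zero _ (mul_ne_zero hq hα))) (hK0 0)
  intro l
  have hc : (if Even l then Λ₀ ^ (4 * h + 1) else (Λ₀ ^ (4 * h + 1))⁻¹) = lam l ^ (4 * h + 1) := by
    rw [hlam]; split_ifs
    · rfl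
    · rw [inv_pow]
  rw [hc, eq_div_iff (Finset.prod_ne_zero_iff.mpr fun _ _ => hy0 _)]
  have hY : y (l + 2 * (h : ℤ)) * y l * ∏ k ∈ Finset.range (2 * h - 1), y (l + (k : ℤ) + 1)
      = ∏ j ∈ Finset.range (2 * h + 1), y (l + (j : ℤ)) := by
    obtain ⟨m, rfl⟩ : ∃ m, h = m + 1 := ⟨h - 1, by omega⟩
    rw [show 2 * (m + 1) - 1 = 2 * m + 1 by omega,
      show 2 * (m + 1) = 2 * m + 1 + 1 by ring, Finset.prod_range_succ _ (2 * m + 1 + 1),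
      Finset.prod_range_succ' _ (2 * m + 1)]
    push_cast
    simp only [add_zero, ← add_assoc]
    rw [show l + 2 * ((m : ℤ) + 1) = l + 2 * (m : ℤ) + 1 + 1 by ring]
    ring
  rw [hY]
  have A := P1 l h
  have B := P2 l (2 * h + 1)
  rw [PL, ← hK, hKq] at B
  rw [Finset.prod_range_succ (fun j : ℕ => U (l + (j : ℤ))),
    Finset.prod_range_succ' (fun j : ℕ => U (l + (j : ℤ) + 2 * (h : ℤ)))] at B
  have e : ∀ j : ℕ, l + ((j + 1 : ℕ) : ℤ) + 2 * (h : ℤ) = l + 2 * (h : ℤ) + 1 + (j : ℤ) := by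
    intro j; push_cast; ring
  simp only [e] at B
  push_cast at B
  rw [add_zero] at B
  have hV : (∏ j ∈ Finset.range (2 * h), U (l + (j : ℤ))) ≠ 0 :=
    Finset.prod_ne_zero_iff.mpr fun _ _ => hU _
  have hW := hU (l + 2 * (h : ℤ))
  generalize (∏ j ∈ Finset.range (2 * h), U (l + (j : ℤ))) = V at *
  generalize (∏ j ∈ Finset.range (2 * h), U (l + 2 * (h : ℤ) + 1 + (j : ℤ))) = W at *
  generalize (∏ j ∈ Finset.range (2 * h + 1), y (l + (j : ℤ))) = Y at *
  generalize (∏ k ∈ Finset.range h, (y (l + 2 * (k : ℤ) + 1) + 1)) = Z at *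
  have hA : (-1) ^ h * lam l ^ (4 * h) * (Z * V) = W := by
    rw [A, pow_mul, ← mul_assoc, mul_assoc ((-1 : ℂ) ^ h), ← mul_pow, ← mul_pow]
    have := hl0 l
    have : (-1 : ℂ) * (lam l ^ 4 * -((lam l)⁻¹ ^ 4)) = 1 := by field_simp
    rw [this]; simp
  apply mul_right_cancel₀ (mul_ne_zero hV hW)
  rw [B, ← hA]
  ring
end
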